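/- arXiv:1905.08142 — 2 statements merged into one kernel-verified Lean document; each statement's English description precedes it below -/
import Mathlib

section
/- Let K = [-1,1]^n, let λ ≥ -1/2, and equip K with the weight function ŵ_λ(x) = ∏_{i=1}^n (1 - x_i^2)^λ. Let f be an n-variate real polynomial and let a ∈ K be a global minimizer of f on K. Then there exists a constant c > 0 (depending on n, λ, f and a) such that for every integer r ≥ 1 one has E^{(r)}_{K,ŵ_λ}(f) ≤ c / r^2. -/
open MeasureTheory
noncomputable section

/-- A polynomial is a sum of squares. -/
def IsSOS {n : ℕ} (q : MvPolynomial (Fin n) ℝ) : Prop :=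
  ∃ (m : ℕ) (p : Fin m → MvPolynomial (Fin n) ℝ), q = ∑ i, p i ^ 2

/-- The Lasserre measure-based upper bound `f^{(r)}_{K,w}`: the infimum of
`∫_K f q w dx` over sum-of-squares polynomials `q` of degree at most `2r`
with `∫_K q w dx = 1`. -/
noncomputable def lasserre {n : ℕ} (r : ℕ) (K : Set (EuclideanSpace ℝ (Fin n)))
    (w f : EuclideanSpace ℝ (Fin n) → ℝ) : ℝ :=
  sInf { v : ℝ | ∃ q : MvPolynomial (Fin n) ℝ, IsSOS q ∧ q.totalDegree ≤ 2 * r ∧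
    (∫ x in K, MvPolynomial.eval (fun i => x i) q * w x) = 1 ∧
    v = ∫ x in K, f x * MvPolynomial.eval (fun i => x i) q * w x }

/-- The error `E^{(r)}_{K,w}(f) = f^{(r)}_{K,w} - min_{x ∈ K} f(x)`. -/
noncomputable def lasserreError {n : ℕ} (r : ℕ) (K : Set (EuclideanSpace ℝ (Fin n)))
    (w f : EuclideanSpace ℝ (Fin n) → ℝ) : ℝ :=
  lasserre r K w f - sInf (f '' K)

open Polynomial in
/-- A Jackson-type kernel: a polynomial of degree at most `m - 1` that is of size `m ^ 2` on
`[0, 1 / m ^ 2]` and decays like `2 / u` on `[0, 2]`. -/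
lemma exists_jackson_kernel (m : ℕ) (hm : 1 ≤ m) : ∃ R : Polynomial ℝ, R.natDegree ≤ m - 1 ∧
    (∀ u ∈ Set.Icc (0 : ℝ) 2, |R.eval u * u| ≤ 2) ∧
    ∀ u ∈ Set.Icc (0 : ℝ) (1 / (m : ℝ) ^ 2), (m : ℝ) ^ 2 / 4 ≤ R.eval u := by
  set P : ℝ[X] := 1 - (Chebyshev.T ℝ m).comp (1 - X) with hP
  have hm0 : (0 : ℝ) < m := by exact_mod_cast hm
  have hroot : P.IsRoot 0 := by simp [hP, Polynomial.IsRoot, eval_comp]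
  obtain ⟨R, hR⟩ := dvd_iff_isRoot.mpr hroot
  rw [C_0, sub_zero] at hR
  have heval (u : ℝ) : R.eval u * u = 1 - (Chebyshev.T ℝ m).eval (1 - u) := by
    have := congrArg (eval u) hR
    simp only [hP, eval_sub, eval_one, eval_comp, eval_X, eval_mul] at this
    linarith
  have hdegP : P.natDegree ≤ m := by
    refine (natDegree_sub_le _ _).trans ?_
    have h1 : (1 - X : ℝ[X]).natDegree ≤ 1 := by
      refine (natDegree_sub_le _ _).trans ?_
      simp
    have h2 := natDegree_comp_le (p := Chebyshev.T ℝ (m : ℤ)) (q := (1 - X : ℝ[X]))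
    rw [Chebyshev.natDegree_T] at h2
    simp only [natDegree_one, Int.natAbs_natCast] at h2 ⊢
    have := Nat.mul_le_mul_left m h1
    omega
  refine ⟨R, ?_, fun u hu ↦ ?_, ?_⟩
  · by_cases hR0 : R = 0
    · simp [hR0]
    · rw [hR, natDegree_mul X_ne_zero hR0, natDegree_X] at hdegP
      omega
  · rw [heval]
    have := Chebyshev.eval_T_real_mem_Icc (m : ℤ) (x := 1 - u)
      ⟨by linarith [hu.2], by linarith [hu.1]⟩
    rw [abs_le]
    constructor <;> linarith [this.1, this.2]
  · have hclosed : IsClosed {u : ℝ | (m : ℝ) ^ 2 / 4 ≤ R.eval u} :=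
      isClosed_le continuous_const R.continuous
    have hne : (0 : ℝ) ≠ 1 / (m : ℝ) ^ 2 := by positivity
    rw [← closure_Ioc hne]
    refine fun u hu ↦ closure_minimal (fun v hv ↦ ?_) hclosed hu
    have hm1 : (1 : ℝ) ≤ m := by exact_mod_cast hm
    have hv1 : v ≤ 1 := hv.2.trans (by rw [div_le_one (by positivity)]; nlinarith)
    set x := Real.arccos (1 - v) / 2 with hx
    have hcos : 1 - v = Real.cos (2 * x) := by
      rw [hx, mul_div_cancel₀ _ two_ne_zero, Real.cos_arccos] <;> linarith [hv.1]
    have hv2 : v = 2 * Real.sin x ^ 2 := by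
      have := Real.cos_sq x
      have := Real.sin_sq_add_cos_sq x
      linarith
    have hx0 : 0 ≤ x := by have := Real.arccos_nonneg (1 - v); positivity
    have hxpi : x ≤ Real.pi / 2 := by have := Real.arccos_le_pi (1 - v); linarith
    have hs1 : 2 / Real.pi * x ≤ Real.sin x := Real.mul_le_sin hx0 hxpi
    have hs2 : Real.sin x ≤ x := Real.sin_le hx0
    have hpi := Real.pi_pos
    have hsx : Real.sin x * m ≤ 1 := by
      have h := hv.2
      rw [hv2, le_div_iff₀ (by positivity)] at h
      have h0 : 0 ≤ Real.sin x := le_trans (by positivity) hs1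
      by_contra! hc
      nlinarith
    have hmx : m * x ≤ Real.pi / 2 := by
      have : 2 / Real.pi * x * m ≤ 1 := le_trans (by gcongr) hsx
      rw [div_mul_eq_mul_div, div_mul_eq_mul_div, div_le_one hpi] at this
      linarith
    have hs3 := Real.mul_le_sin (by positivity) hmx
    have hT : R.eval v * v = 2 * Real.sin (m * x) ^ 2 := by
      rw [heval, hcos, Chebyshev.T_real_cos]
      have h1 := Real.cos_sq (m * x)
      have h2 := Real.sin_sq_add_cos_sq (m * x)
      rw [show ((m : ℤ) : ℝ) * (2 * x) = 2 * (m * x) by push_cast; ring]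
      linarith
    have hpi4 : 1 / 2 ≤ 2 / Real.pi := by
      rw [div_le_div_iff₀ two_pos hpi]; linarith [Real.pi_le_four]
    have hsin0 : 0 ≤ Real.sin x := le_trans (by positivity) hs1
    have hlow : 1 / 2 * (m * Real.sin x) ≤ Real.sin (m * x) :=
      calc 1 / 2 * (m * Real.sin x) ≤ 2 / Real.pi * (m * x) := by
            have : 0 ≤ m * Real.sin x := by positivity
            gcongr
        _ ≤ _ := hs3
    refine le_of_mul_le_mul_right ?_ hv.1
    rw [hT]
    have := pow_le_pow_left₀ (by positivity) hlow 2
    calc (m : ℝ) ^ 2 / 4 * v = 2 * (1 / 2 * (m * Real.sin x)) ^ 2 := by rw [hv2]; ring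
      _ ≤ _ := by linarith

lemma integrable_polynomial {ρ : Measure ℝ} [IsFiniteMeasure ρ]
    (hρ : ∀ᵐ t ∂ρ, t ∈ Set.Icc (-1 : ℝ) 1) {g : ℝ → ℝ} (hg : Continuous g) :
    Integrable g ρ := by
  obtain ⟨B, hB⟩ := isCompact_Icc.exists_bound_of_continuousOn (s := Set.Icc (-1 : ℝ) 1)
    hg.continuousOn
  exact Integrable.of_bound hg.aestronglyMeasurable B (hρ.mono fun t ht ↦ hB t ht)

/-- If the sublevel sets of `U` have positive and doubling `ρ`-measure, then suitable polynomial
densities of degree `d` concentrate on `U ≤ O(1 / d ^ 2)`. -/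
lemma exists_needle {ρ : Measure ℝ} [IsFiniteMeasure ρ]
    (hρ : ∀ᵐ t ∂ρ, t ∈ Set.Icc (-1 : ℝ) 1) (U : Polynomial ℝ) (hdeg : U.natDegree ≤ 2)
    (hU : ∀ t ∈ Set.Icc (-1 : ℝ) 1, U.eval t ∈ Set.Icc (0 : ℝ) 2)
    (hpos : ∀ ε > 0, 0 < ρ.real {t | U.eval t ≤ ε}) (D : ℝ)
    (hD : ∀ ε > 0, ρ.real {t | U.eval t ≤ 2 * ε} ≤ D * ρ.real {t | U.eval t ≤ ε}) :
    ∃ c : ℝ, 0 < c ∧ ∀ d : ℕ, ∃ p : Polynomial ℝ, p.natDegree ≤ d ∧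
      ∫ t, p.eval t ^ 2 ∂ρ = 1 ∧ ∫ t, p.eval t ^ 2 * U.eval t ∂ρ ≤ c / ((d : ℝ) + 1) ^ 2 := by
  set M : ℝ → ℝ := fun ε ↦ ρ.real {t | U.eval t ≤ ε} with hM
  have hD0 : 0 < D := by
    have h1 := hpos 1 one_pos
    have h2 := hpos (2 * 1) (by norm_num)
    have h3 := hD 1 one_pos
    by_contra! hc
    nlinarith
  obtain ⟨j, hj⟩ := pow_unbounded_of_one_lt D (show (1 : ℝ) < 4 by norm_num)
  refine ⟨4 * ((j : ℝ) + 1) ^ 2 * (1 + 2 * D * 64 ^ (j + 1)), by positivity, fun d ↦ ?_⟩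
  set m := d / (2 * (j + 1)) + 1 with hm
  obtain ⟨R, hRdeg, hR2, hRlow⟩ := exists_jackson_kernel m (Nat.succ_pos _)
  have hm0 : (0 : ℝ) < m := by positivity
  set ε : ℝ := 1 / (m : ℝ) ^ 2 with hε
  have hε0 : 0 < ε := by positivity
  set p₀ : Polynomial ℝ := (R.comp U) ^ (j + 1) with hp₀
  have hp₀eval (t : ℝ) : p₀.eval t ^ 2 = (R.eval (U.eval t)) ^ (2 * j + 2) := by
    simp only [hp₀, Polynomial.eval_pow, Polynomial.eval_comp]
    ring
  have hp₀deg : p₀.natDegree ≤ d := by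
    calc p₀.natDegree ≤ (j + 1) * (R.natDegree * U.natDegree) := by
          refine Polynomial.natDegree_pow_le.trans ?_
          gcongr
          exact Polynomial.natDegree_comp_le
      _ ≤ (j + 1) * ((m - 1) * 2) := by gcongr
      _ = d / (2 * (j + 1)) * (2 * (j + 1)) := by simp only [hm, Nat.add_sub_cancel]; ring
      _ ≤ d := Nat.div_mul_le_self _ _
  have hint : Integrable (fun t ↦ p₀.eval t ^ 2) ρ :=
    integrable_polynomial hρ (p₀.continuous.pow 2)
  have hmeas (δ : ℝ) : MeasurableSet {t | U.eval t ≤ δ} :=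
    measurableSet_le U.continuous.measurable measurable_const
  set A := ∫ t, p₀.eval t ^ 2 ∂ρ with hA
  have hAlow : (1 / (4 * ε)) ^ (2 * j + 2) * M ε ≤ A := by
    have : ∫ t, {t | U.eval t ≤ ε}.indicator (fun _ ↦ (1 / (4 * ε)) ^ (2 * j + 2)) t ∂ρ ≤ A := by
      refine integral_mono_ae ((integrable_const _).indicator (hmeas ε)) hint ?_
      filter_upwards [hρ] with t ht
      rw [hp₀eval]
      by_cases h : U.eval t ≤ ε
      · rw [Set.indicator_of_mem (by exact h)]
        have := hRlow _ ⟨(hU t ht).1, h⟩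
        refine pow_le_pow_left₀ (by positivity) (le_trans (le_of_eq ?_) this) _
        rw [hε]
        field_simp
      · rw [Set.indicator_of_notMem (by exact h)]
        exact Even.pow_nonneg ⟨j + 1, by ring⟩ _
    rw [integral_indicator_const _ (hmeas ε)] at this
    simpa [hM, mul_comm] using this
  have hApos : 0 < A := lt_of_lt_of_le (mul_pos (by positivity) (hpos ε hε0)) hAlow
  obtain ⟨J, hJ⟩ := pow_unbounded_of_one_lt (2 / ε) (show (1 : ℝ) < 2 by norm_num)
  have hMpow (i : ℕ) : M (2 ^ i * ε) ≤ D ^ i * M ε := by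
    induction i with
    | zero => simp
    | succ i ih =>
      have := hD (2 ^ i * ε) (by positivity)
      rw [show (2 : ℝ) ^ (i + 1) * ε = 2 * (2 ^ i * ε) by ring]
      calc M (2 * (2 ^ i * ε)) ≤ D * M (2 ^ i * ε) := this
        _ ≤ D * (D ^ i * M ε) := by gcongr
        _ = _ := by ring
  have hB : ∫ t, p₀.eval t ^ 2 * U.eval t ∂ρ ≤
      ε * A + 4 ^ (j + 1) * ∑ i ∈ Finset.range J,
        ((2 ^ i * ε) ^ (2 * j + 1))⁻¹ * M (2 ^ (i + 1) * ε) := by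
    have hsum : ∫ t, (ε * p₀.eval t ^ 2 + 4 ^ (j + 1) * ∑ i ∈ Finset.range J,
        {t | U.eval t ≤ 2 ^ (i + 1) * ε}.indicator (fun _ ↦ ((2 ^ i * ε) ^ (2 * j + 1))⁻¹) t) ∂ρ =
        ε * A + 4 ^ (j + 1) * ∑ i ∈ Finset.range J,
        ((2 ^ i * ε) ^ (2 * j + 1))⁻¹ * M (2 ^ (i + 1) * ε) := by
      rw [integral_add (hint.const_mul _) (Integrable.const_mul (integrable_finsetSum _
        fun i _ ↦ (integrable_const _).indicator (hmeas _)) _), integral_const_mul,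
        integral_const_mul, integral_finsetSum _
        fun i _ ↦ (integrable_const _).indicator (hmeas _)]
      simp_rw [integral_indicator_const _ (hmeas _), smul_eq_mul, hM, mul_comm (ρ.real _), hA]
    rw [← hsum]
    refine integral_mono_ae
      (integrable_polynomial hρ ((p₀.continuous.pow 2).mul U.continuous))
      ((hint.const_mul _).add (Integrable.const_mul (integrable_finsetSum _
        fun i _ ↦ (integrable_const _).indicator (hmeas _)) _)) ?_
    filter_upwards [hρ] with t ht
    obtain ⟨hv0, hv2⟩ := hU t ht
    have hRt := hR2 _ (hU t ht)
    rw [hp₀eval]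
    set v := U.eval t with hv
    have hterm (i : ℕ) : 0 ≤
        {t | U.eval t ≤ 2 ^ (i + 1) * ε}.indicator (fun _ ↦ ((2 ^ i * ε) ^ (2 * j + 1))⁻¹) t :=
      Set.indicator_nonneg (fun _ _ ↦ by positivity) _
    have hp0 : 0 ≤ R.eval v ^ (2 * j + 2) := Even.pow_nonneg ⟨j + 1, by ring⟩ _
    by_cases h : v ≤ ε
    · have h1 : R.eval v ^ (2 * j + 2) * v ≤ ε * R.eval v ^ (2 * j + 2) := by
        rw [mul_comm]; gcongr
      have h2 := Finset.sum_nonneg fun i (_ : i ∈ Finset.range J) ↦ hterm i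
      have : (0 : ℝ) ≤ 4 ^ (j + 1) := by positivity
      exact h1.trans (le_add_of_nonneg_right (mul_nonneg this h2))
    · push Not at h
      have hvpos : 0 < v := hε0.trans h
      obtain ⟨i, hi1, hi2⟩ := exists_nat_pow_near (x := v / ε) (y := 2)
        (by rw [le_div_iff₀ hε0]; linarith) (by norm_num)
      rw [le_div_iff₀ hε0] at hi1
      rw [div_lt_iff₀ hε0] at hi2
      have hiJ : i < J := by
        have : (2 : ℝ) ^ i < 2 ^ J := by
          refine lt_of_le_of_lt ?_ hJ
          rw [le_div_iff₀ hε0]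
          linarith
        exact (pow_lt_pow_iff_right₀ (by norm_num)).mp this
      have h1 : R.eval v ^ (2 * j + 2) * v ≤ 4 ^ (j + 1) * ((2 ^ i * ε) ^ (2 * j + 1))⁻¹ := by
        rw [← div_eq_mul_inv, le_div_iff₀ (by positivity)]
        calc R.eval v ^ (2 * j + 2) * v * (2 ^ i * ε) ^ (2 * j + 1)
            ≤ R.eval v ^ (2 * j + 2) * v * v ^ (2 * j + 1) := by gcongr
          _ = (|R.eval v * v| ^ 2) ^ (j + 1) := by rw [sq_abs]; ring
          _ ≤ (2 ^ 2) ^ (j + 1) := by gcongr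
          _ = _ := by norm_num
      have h2 : ((2 ^ i * ε) ^ (2 * j + 1))⁻¹ ≤ ∑ i ∈ Finset.range J,
          {t | U.eval t ≤ 2 ^ (i + 1) * ε}.indicator
            (fun _ ↦ ((2 ^ i * ε) ^ (2 * j + 1))⁻¹) t := by
        refine le_trans (le_of_eq ?_) (Finset.single_le_sum (fun i _ ↦ hterm i)
          (Finset.mem_range.mpr hiJ))
        rw [Set.indicator_of_mem (by exact hi2.le)]
      calc _ ≤ _ := h1
        _ ≤ _ := mul_le_mul_of_nonneg_left h2 (by positivity)
        _ ≤ _ := le_add_of_nonneg_left (by positivity)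
  have hsum2 : ∑ i ∈ Finset.range J, ((2 ^ i * ε) ^ (2 * j + 1))⁻¹ * M (2 ^ (i + 1) * ε) ≤
      2 * D * ((ε ^ (2 * j + 1))⁻¹ * M ε) := by
    have hMε : 0 < M ε := hpos ε hε0
    have : ∀ i ∈ Finset.range J, ((2 ^ i * ε) ^ (2 * j + 1))⁻¹ * M (2 ^ (i + 1) * ε) ≤
        (1 / 2) ^ i * (D * ((ε ^ (2 * j + 1))⁻¹ * M ε)) := by
      intro i _
      calc ((2 ^ i * ε) ^ (2 * j + 1))⁻¹ * M (2 ^ (i + 1) * ε)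
          ≤ ((2 ^ i * ε) ^ (2 * j + 1))⁻¹ * (D ^ (i + 1) * M ε) := by
            gcongr
            exact hMpow _
        _ = (D / 2 ^ (2 * j + 1)) ^ i * (D * ((ε ^ (2 * j + 1))⁻¹ * M ε)) := by
            rw [div_pow, ← pow_mul, mul_pow, ← pow_mul, mul_comm i]
            field_simp
            ring
        _ ≤ _ := by
            gcongr ?_ ^ i * _
            rw [div_le_div_iff₀ (by positivity) (by norm_num), pow_succ, pow_mul]
            norm_num
            linarith
    refine (Finset.sum_le_sum this).trans ?_
    rw [← Finset.sum_mul, mul_assoc]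
    gcongr
    exact sum_geometric_two_le J
  have hfin : ∫ t, p₀.eval t ^ 2 * U.eval t ∂ρ ≤ ε * (1 + 2 * D * 64 ^ (j + 1)) * A := by
    have h1 : (ε ^ (2 * j + 1))⁻¹ * M ε ≤ ε * 16 ^ (j + 1) * A := by
      calc (ε ^ (2 * j + 1))⁻¹ * M ε
          = ε * 16 ^ (j + 1) * ((1 / (4 * ε)) ^ (2 * j + 2) * M ε) := by
            have : (16 : ℝ) ^ (j + 1) = 4 ^ (2 * j + 2) := by
              rw [show 2 * j + 2 = 2 * (j + 1) by ring, pow_mul]; norm_num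
            rw [this]
            clear_value ε
            rw [div_pow, mul_pow, one_pow, pow_succ ε (2 * j + 1)]
            field_simp
        _ ≤ _ := by gcongr
    calc _ ≤ _ := hB
      _ ≤ ε * A + 4 ^ (j + 1) * (2 * D * (ε * 16 ^ (j + 1) * A)) := by
          gcongr
          exact hsum2.trans (by gcongr)
      _ = _ := by
          rw [show (64 : ℝ) = 4 * 16 by norm_num, mul_pow]
          ring
  refine ⟨Polynomial.C (√A)⁻¹ * p₀, (Polynomial.natDegree_C_mul_le _ _).trans hp₀deg, ?_, ?_⟩
  · simp only [Polynomial.eval_mul, Polynomial.eval_C, mul_pow, inv_pow, Real.sq_sqrt hApos.le]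
    rw [integral_const_mul, ← hA, inv_mul_cancel₀ hApos.ne']
  · simp only [Polynomial.eval_mul, Polynomial.eval_C, mul_pow, inv_pow, Real.sq_sqrt hApos.le,
      mul_assoc]
    rw [integral_const_mul, inv_mul_le_iff₀ hApos]
    refine hfin.trans ?_
    have hdm : (d : ℝ) + 1 ≤ 2 * ((j : ℝ) + 1) * m := by
      have := Nat.lt_mul_div_succ d (show 0 < 2 * (j + 1) by omega)
      exact_mod_cast this
    have hε' : ε ≤ 4 * ((j : ℝ) + 1) ^ 2 / ((d : ℝ) + 1) ^ 2 := by
      rw [hε, div_le_div_iff₀ (by positivity) (by positivity), one_mul]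
      calc ((d : ℝ) + 1) ^ 2 ≤ (2 * ((j : ℝ) + 1) * m) ^ 2 := by gcongr
        _ = _ := by ring
    calc _ ≤ 4 * ((j : ℝ) + 1) ^ 2 / ((d : ℝ) + 1) ^ 2 * (1 + 2 * D * 64 ^ (j + 1)) * A := by
          gcongr
      _ = _ := by ring

/-- The one-dimensional Gegenbauer weight. -/
def gegenbauerWeight (lam t : ℝ) : ℝ := (1 - t ^ 2) ^ lam

/-- Lebesgue measure on `[-1, 1]`. -/
def intervalMeasure : Measure ℝ := volume.restrict (Set.Icc (-1) 1)

/-- The measure on `[-1, 1]` with density the Gegenbauer weight. -/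
def gegenbauerMeasure (lam : ℝ) : Measure ℝ :=
  intervalMeasure.withDensity fun t ↦ ENNReal.ofReal (gegenbauerWeight lam t)

instance : IsFiniteMeasure intervalMeasure := by
  unfold intervalMeasure; infer_instance

lemma ae_mem_intervalMeasure : ∀ᵐ t ∂intervalMeasure, t ∈ Set.Icc (-1 : ℝ) 1 :=
  ae_restrict_mem measurableSet_Icc

lemma gegenbauerWeight_nonneg (lam : ℝ) {t : ℝ} (ht : t ∈ Set.Icc (-1 : ℝ) 1) :
    0 ≤ gegenbauerWeight lam t :=
  Real.rpow_nonneg (by nlinarith [ht.1, ht.2]) _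

lemma measurable_gegenbauerWeight (lam : ℝ) : Measurable (gegenbauerWeight lam) := by
  unfold gegenbauerWeight; fun_prop

lemma integrable_gegenbauerWeight {lam : ℝ} (hlam : -(1 / 2 : ℝ) ≤ lam) :
    Integrable (gegenbauerWeight lam) intervalMeasure := by
  have h := Polynomial.Chebyshev.intervalIntegrable_sqrt_one_sub_sq_inv
  rw [intervalIntegrable_iff, Set.uIoc_of_le (by norm_num),
    integrableOn_Ioc_iff_integrableOn_Ioo] at h
  change IntegrableOn _ _ _
  rw [integrableOn_Icc_iff_integrableOn_Ioo]
  refine Integrable.mono' h (measurable_gegenbauerWeight lam).aestronglyMeasurable ?_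
  filter_upwards [ae_restrict_mem measurableSet_Ioo] with t ht
  have h0 : 0 < 1 - t ^ 2 := by nlinarith [ht.1, ht.2]
  rw [Real.norm_of_nonneg (gegenbauerWeight_nonneg lam ⟨ht.1.le, ht.2.le⟩), Real.sqrt_eq_rpow,
    Real.inv_rpow h0.le, ← Real.rpow_neg h0.le]
  exact Real.rpow_le_rpow_of_exponent_ge h0 (by nlinarith) hlam

lemma isFiniteMeasure_gegenbauerMeasure {lam : ℝ} (hlam : -(1 / 2 : ℝ) ≤ lam) :
    IsFiniteMeasure (gegenbauerMeasure lam) :=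
  isFiniteMeasure_withDensity_ofReal (integrable_gegenbauerWeight hlam).2

lemma ae_mem_gegenbauerMeasure (lam : ℝ) :
    ∀ᵐ t ∂gegenbauerMeasure lam, t ∈ Set.Icc (-1 : ℝ) 1 :=
  (withDensity_absolutelyContinuous _ _).ae_le ae_mem_intervalMeasure

lemma integral_gegenbauerMeasure (lam : ℝ) (g : ℝ → ℝ) :
    ∫ t, g t ∂gegenbauerMeasure lam = ∫ t, g t * gegenbauerWeight lam t ∂intervalMeasure := by
  rw [gegenbauerMeasure, integral_withDensity_eq_integral_toReal_smul
    (measurable_gegenbauerWeight lam).ennreal_ofReal (by simp)]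
  refine integral_congr_ae ?_
  filter_upwards [ae_mem_intervalMeasure] with t ht
  rw [ENNReal.toReal_ofReal (gegenbauerWeight_nonneg lam ht), smul_eq_mul, mul_comm]

lemma gegenbauerMeasure_real (lam : ℝ) {S : Set ℝ} (hS : MeasurableSet S) :
    (gegenbauerMeasure lam).real S = ∫ t in S ∩ Set.Icc (-1) 1, gegenbauerWeight lam t := by
  have h := integral_gegenbauerMeasure lam (S.indicator 1)
  rw [integral_indicator_one hS] at h
  rw [h, intervalMeasure, ← integral_indicator measurableSet_Icc,
    ← integral_indicator (hS.inter measurableSet_Icc)]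
  congr 1 with t
  by_cases h1 : t ∈ Set.Icc (-1 : ℝ) 1 <;> by_cases h2 : t ∈ S <;> simp [h1, h2]

lemma doubling_of_comparable {M φ : ℝ → ℝ} (hM : Monotone M) {B ε₀ c C D : ℝ} (hB : ∀ ε, M ε ≤ B)
    (hε₀ : 0 < ε₀) (hc : 0 < c) (hφ : ∀ ε > 0, 0 < φ ε) (hφD : ∀ ε > 0, φ (2 * ε) ≤ D * φ ε)
    (hlow : ∀ ε > 0, ε ≤ ε₀ → c * φ ε ≤ M ε) (hup : ∀ ε > 0, ε ≤ ε₀ → M ε ≤ C * φ ε) :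
    (∀ ε > 0, 0 < M ε) ∧ ∃ D' : ℝ, ∀ ε > 0, M (2 * ε) ≤ D' * M ε := by
  have hpos : ∀ ε > 0, 0 < M ε := fun ε hε ↦
    lt_of_lt_of_le (mul_pos hc (hφ _ (lt_min hε hε₀)))
      ((hlow _ (lt_min hε hε₀) (min_le_right _ _)).trans (hM (min_le_left _ _)))
  have hC : 0 < C := by
    have h1 := (hpos ε₀ hε₀).trans_le (hup ε₀ hε₀ le_rfl)
    exact pos_of_mul_pos_left h1 (hφ ε₀ hε₀).le
  refine ⟨hpos, max (C * D / c) (B / M (ε₀ / 2)), fun ε hε ↦ ?_⟩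
  have hMε := hpos ε hε
  rcases le_or_gt (2 * ε) ε₀ with h | h
  · have hD : 0 < D := pos_of_mul_pos_left ((hφ (2 * ε) (by positivity)).trans_le (hφD ε hε))
      (hφ ε hε).le
    calc M (2 * ε) ≤ C * φ (2 * ε) := hup _ (by positivity) h
      _ ≤ C * (D * φ ε) := by gcongr; exact hφD ε hε
      _ = C * D / c * (c * φ ε) := by field_simp
      _ ≤ C * D / c * M ε := by gcongr; exact hlow ε hε (by linarith)
      _ ≤ _ := by gcongr; exact le_max_left _ _
  · have h2 := hpos (ε₀ / 2) (by positivity)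
    have hB0 : 0 ≤ B := h2.le.trans (hB _)
    calc M (2 * ε) ≤ B := hB _
      _ = B / M (ε₀ / 2) * M (ε₀ / 2) := by field_simp
      _ ≤ B / M (ε₀ / 2) * M ε := by gcongr; exact hM (by linarith)
      _ ≤ _ := by gcongr; exact le_max_right _ _

lemma monotone_real_sublevel {ρ : Measure ℝ} [IsFiniteMeasure ρ] (g : ℝ → ℝ) :
    Monotone fun ε ↦ ρ.real {t | g t ≤ ε} :=
  fun _ _ h ↦ measureReal_mono fun _ ht ↦ le_trans ht h

lemma exists_pos_bounds {g : ℝ → ℝ} {x y : ℝ} (hg : ContinuousOn g (Set.Icc x y))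
    (hpos : ∀ t ∈ Set.Icc x y, 0 < g t) (hxy : x ≤ y) :
    ∃ c C : ℝ, 0 < c ∧ ∀ t ∈ Set.Icc x y, c ≤ g t ∧ g t ≤ C := by
  have hne : (Set.Icc x y).Nonempty := Set.nonempty_Icc.mpr hxy
  obtain ⟨s, hs, hs'⟩ := isCompact_Icc.exists_isMinOn hne hg
  obtain ⟨r, hr, hr'⟩ := isCompact_Icc.exists_isMaxOn hne hg
  exact ⟨g s, g r, hpos s hs, fun t ht ↦ ⟨hs' ht, hr' ht⟩⟩

lemma doubling_interior {lam : ℝ} (hlam : -(1 / 2 : ℝ) ≤ lam) {a : ℝ}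
    (ha : a ∈ Set.Ioo (-1 : ℝ) 1) :
    (∀ ε > 0, 0 < (gegenbauerMeasure lam).real {t | (t - a) ^ 2 / 2 ≤ ε}) ∧
    ∃ D : ℝ, ∀ ε > 0, (gegenbauerMeasure lam).real {t | (t - a) ^ 2 / 2 ≤ 2 * ε} ≤
      D * (gegenbauerMeasure lam).real {t | (t - a) ^ 2 / 2 ≤ ε} := by
  have := isFiniteMeasure_gegenbauerMeasure hlam
  obtain ⟨δ, hδ, hδ1, hδ2⟩ : ∃ δ > 0, -1 < a - δ ∧ a + δ < 1 := by
    refine ⟨min (a + 1) (1 - a) / 2, ?_, ?_, ?_⟩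
    · have := lt_min (show 0 < a + 1 by linarith [ha.1]) (show 0 < 1 - a by linarith [ha.2])
      positivity
    · linarith [min_le_left (a + 1) (1 - a), ha.1]
    · linarith [min_le_right (a + 1) (1 - a), ha.2]
  have hbase : ∀ t ∈ Set.Icc (a - δ) (a + δ), 0 < 1 - t ^ 2 := fun t ht ↦ by
    nlinarith [ht.1, ht.2]
  obtain ⟨c, C, hc, hcC⟩ := exists_pos_bounds (g := gegenbauerWeight lam) (x := a - δ) (y := a + δ)
    (ContinuousOn.rpow_const (by fun_prop) fun t ht ↦ Or.inl (hbase t ht).ne')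
    (fun t ht ↦ Real.rpow_pos_of_pos (hbase t ht) _) (by linarith)
  have key : ∀ ε > 0, ε ≤ δ ^ 2 / 2 →
      Set.Icc (a - √(2 * ε)) (a + √(2 * ε)) ⊆ Set.Icc (a - δ) (a + δ) ∧
      (gegenbauerMeasure lam).real {t | (t - a) ^ 2 / 2 ≤ ε} =
        ∫ t in Set.Icc (a - √(2 * ε)) (a + √(2 * ε)), gegenbauerWeight lam t := by
    intro ε hε hεδ
    have hs : √(2 * ε) ≤ δ := by
      rw [Real.sqrt_le_left hδ.le]; linarith
    refine ⟨Set.Icc_subset_Icc (by linarith) (by linarith), ?_⟩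
    rw [gegenbauerMeasure_real lam (measurableSet_le (by fun_prop) (by fun_prop))]
    congr 2
    ext t
    have : (t - a) ^ 2 / 2 ≤ ε ↔ |t - a| ≤ √(2 * ε) := by
      rw [Real.le_sqrt (abs_nonneg _) (by positivity), sq_abs, div_le_iff₀ two_pos, mul_comm ε]
    simp only [Set.mem_inter_iff, Set.mem_ofPred_eq, this, abs_le, Set.mem_Icc]
    constructor
    · rintro ⟨⟨h1, h2⟩, -⟩
      constructor <;> linarith
    · rintro ⟨h1, h2⟩
      refine ⟨⟨?_, ?_⟩, ?_, ?_⟩ <;> linarith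
  have hvol (ε : ℝ) (k : ℝ) : ∫ _ in Set.Icc (a - √(2 * ε)) (a + √(2 * ε)), k =
      k * (2 * √(2 * ε)) := by
    rw [setIntegral_const, Real.volume_real_Icc_of_le (by linarith [Real.sqrt_nonneg (2 * ε)]),
      smul_eq_mul]
    ring
  have hint : ∀ {S : Set ℝ}, S ⊆ Set.Icc (a - δ) (a + δ) →
      IntegrableOn (gegenbauerWeight lam) S := fun {S} hS ↦
    IntegrableOn.mono_set (integrable_gegenbauerWeight hlam)
      (hS.trans (Set.Icc_subset_Icc hδ1.le hδ2.le))
  refine doubling_of_comparable (monotone_real_sublevel _) (fun ε ↦ measureReal_mono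
    (Set.subset_univ _)) (φ := fun ε ↦ 2 * √(2 * ε)) (D := 2) (ε₀ := δ ^ 2 / 2) (by positivity) hc
    (fun ε hε ↦ by positivity) (fun ε hε ↦ ?_) (C := C) (fun ε hε hεδ ↦ ?_) (fun ε hε hεδ ↦ ?_)
  · have : √(2 * (2 * ε)) ≤ 2 * √(2 * ε) := by
      rw [Real.sqrt_le_left (by positivity), mul_pow, Real.sq_sqrt (by positivity)]
      linarith
    linarith
  · obtain ⟨h1, h2⟩ := key ε hε hεδ
    rw [h2, ← hvol]
    exact setIntegral_mono_on (integrableOn_const (by simp)) (hint h1) measurableSet_Icc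
      fun t ht ↦ (hcC t (h1 ht)).1
  · obtain ⟨h1, h2⟩ := key ε hε hεδ
    rw [h2, ← hvol]
    exact setIntegral_mono_on (hint h1) (integrableOn_const (by simp)) measurableSet_Icc
      fun t ht ↦ (hcC t (h1 ht)).2

lemma doubling_right_endpoint {lam : ℝ} (hlam : -(1 / 2 : ℝ) ≤ lam) :
    (∀ ε > 0, 0 < (gegenbauerMeasure lam).real {t | 1 - t ≤ ε}) ∧
    ∃ D : ℝ, ∀ ε > 0, (gegenbauerMeasure lam).real {t | 1 - t ≤ 2 * ε} ≤
      D * (gegenbauerMeasure lam).real {t | 1 - t ≤ ε} := by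
  have := isFiniteMeasure_gegenbauerMeasure hlam
  have hlam1 : 0 < lam + 1 := by linarith
  obtain ⟨c, C, hc, hcC⟩ := exists_pos_bounds (g := fun t : ℝ ↦ (1 + t) ^ lam) (x := 0) (y := 1)
    (ContinuousOn.rpow_const (by fun_prop) fun t ht ↦ Or.inl (by linarith [ht.1]))
    (fun t ht ↦ Real.rpow_pos_of_pos (by linarith [ht.1]) _) zero_le_one
  have hweight : ∀ t ∈ Set.Icc (0 : ℝ) 1,
      gegenbauerWeight lam t = (1 + t) ^ lam * (1 - t) ^ lam := fun t ht ↦ by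
    rw [← Real.mul_rpow (by linarith [ht.1]) (by linarith [ht.2]), gegenbauerWeight]
    ring_nf
  have hII (ε : ℝ) : IntervalIntegrable (fun t : ℝ ↦ (1 - t) ^ lam) volume (1 - ε) 1 := by
    have h := (intervalIntegral.intervalIntegrable_rpow' (a := ε) (b := 0)
      (show -1 < lam by linarith)).comp_sub_left 1
    simpa using h
  have hIOn {ε : ℝ} (hε : 0 < ε) :
      IntegrableOn (fun t : ℝ ↦ (1 - t) ^ lam) (Set.Icc (1 - ε) 1) := by
    have h := hII ε
    rwa [intervalIntegrable_iff_integrableOn_Icc_of_le (by linarith)] at h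
  have hval {ε : ℝ} (hε : 0 < ε) (k : ℝ) : ∫ t in Set.Icc (1 - ε) 1, k * (1 - t) ^ lam =
      k * (ε ^ (lam + 1) / (lam + 1)) := by
    rw [integral_const_mul, integral_Icc_eq_integral_Ioc,
      ← intervalIntegral.integral_of_le (by linarith),
      intervalIntegral.integral_comp_sub_left (fun x ↦ x ^ lam)]
    simp [integral_rpow (a := 0) (b := ε) (Or.inl (show -1 < lam by linarith)),
      Real.zero_rpow hlam1.ne']
  have key : ∀ ε > 0, ε ≤ 1 → (gegenbauerMeasure lam).real {t | 1 - t ≤ ε} =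
      ∫ t in Set.Icc (1 - ε) 1, gegenbauerWeight lam t := by
    intro ε hε hε1
    rw [gegenbauerMeasure_real lam (measurableSet_le (by fun_prop) (by fun_prop))]
    congr 2
    ext t
    simp only [Set.mem_inter_iff, Set.mem_ofPred_eq, Set.mem_Icc]
    constructor
    · rintro ⟨h1, -, h2⟩
      constructor <;> linarith
    · rintro ⟨h1, h2⟩
      refine ⟨?_, ?_, ?_⟩ <;> linarith
  have hint : ∀ ε ≤ 1, IntegrableOn (gegenbauerWeight lam) (Set.Icc (1 - ε) 1) := fun ε hε ↦
    IntegrableOn.mono_set (integrable_gegenbauerWeight hlam)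
      (Set.Icc_subset_Icc (by linarith) le_rfl)
  refine doubling_of_comparable (monotone_real_sublevel _) (fun ε ↦ measureReal_mono
    (Set.subset_univ _)) (φ := fun ε ↦ ε ^ (lam + 1) / (lam + 1)) (D := 2 ^ (lam + 1)) (ε₀ := 1)
    one_pos hc (fun ε hε ↦ by positivity) (fun ε hε ↦ ?_) (C := C) (fun ε hε hε1 ↦ ?_)
    (fun ε hε hε1 ↦ ?_)
  · rw [Real.mul_rpow two_pos.le hε.le, mul_div_assoc]
  · rw [key ε hε hε1, ← hval hε]
    refine setIntegral_mono_on ((hIOn hε).const_mul c) (hint ε hε1) measurableSet_Icc fun t ht ↦ ?_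
    have ht' : t ∈ Set.Icc (0 : ℝ) 1 := ⟨by linarith [ht.1], ht.2⟩
    rw [hweight t ht']
    exact mul_le_mul_of_nonneg_right (hcC t ht').1 (Real.rpow_nonneg (by linarith [ht.2]) _)
  · rw [key ε hε hε1, ← hval hε]
    refine setIntegral_mono_on (hint ε hε1) ((hIOn hε).const_mul C) measurableSet_Icc fun t ht ↦ ?_
    have ht' : t ∈ Set.Icc (0 : ℝ) 1 := ⟨by linarith [ht.1], ht.2⟩
    rw [hweight t ht']
    exact mul_le_mul_of_nonneg_right (hcC t ht').2 (Real.rpow_nonneg (by linarith [ht.2]) _)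

lemma gegenbauerMeasure_real_symm (lam ε : ℝ) :
    (gegenbauerMeasure lam).real {t | 1 + t ≤ ε} =
      (gegenbauerMeasure lam).real {t | 1 - t ≤ ε} := by
  have h1 : MeasurableSet {t : ℝ | 1 + t ≤ ε} := measurableSet_le (by fun_prop) (by fun_prop)
  have h2 : MeasurableSet {t : ℝ | 1 - t ≤ ε} := measurableSet_le (by fun_prop) (by fun_prop)
  rw [gegenbauerMeasure_real lam h1, gegenbauerMeasure_real lam h2,
    ← integral_indicator (h1.inter measurableSet_Icc),
    ← integral_indicator (h2.inter measurableSet_Icc), ← integral_neg_eq_self]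
  congr 1 with t
  have hmem : -t ∈ {t : ℝ | 1 + t ≤ ε} ∩ Set.Icc (-1) 1 ↔
      t ∈ {t : ℝ | 1 - t ≤ ε} ∩ Set.Icc (-1) 1 := by
    simp only [Set.mem_inter_iff, Set.mem_ofPred_eq, Set.mem_Icc, ← sub_eq_add_neg]
    constructor <;> rintro ⟨h, h', h''⟩ <;> refine ⟨h, ?_, ?_⟩ <;> linarith
  simp only [Set.indicator_apply, hmem, gegenbauerWeight, neg_sq]

/-- A polynomial `U` that measures the distance to `a`, together with polynomial densities of
degree `d` for which the mean of `U` is `O(1 / d ^ 2)`. -/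
lemma exists_localizer {lam : ℝ} (hlam : -(1 / 2 : ℝ) ≤ lam) {a : ℝ}
    (ha : a ∈ Set.Icc (-1 : ℝ) 1) : ∃ U : Polynomial ℝ,
    (∀ t ∈ Set.Icc (-1 : ℝ) 1, 0 ≤ U.eval t) ∧
    (∀ l C : ℝ, (a ∈ Set.Ioo (-1 : ℝ) 1 → l = 0) → ∃ C' : ℝ, 0 ≤ C' ∧
      ∀ t ∈ Set.Icc (-1 : ℝ) 1, l * (t - a) + C * (t - a) ^ 2 ≤ C' * U.eval t) ∧
    ∃ c : ℝ, 0 < c ∧ ∀ d : ℕ, ∃ p : Polynomial ℝ, p.natDegree ≤ d ∧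
      ∫ t, p.eval t ^ 2 * gegenbauerWeight lam t ∂intervalMeasure = 1 ∧
      ∫ t, p.eval t ^ 2 * U.eval t * gegenbauerWeight lam t ∂intervalMeasure ≤
        c / ((d : ℝ) + 1) ^ 2 := by
  have := isFiniteMeasure_gegenbauerMeasure hlam
  suffices ∃ U : Polynomial ℝ, U.natDegree ≤ 2 ∧
      (∀ t ∈ Set.Icc (-1 : ℝ) 1, U.eval t ∈ Set.Icc (0 : ℝ) 2) ∧
      (∀ l C : ℝ, (a ∈ Set.Ioo (-1 : ℝ) 1 → l = 0) → ∃ C' : ℝ, 0 ≤ C' ∧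
        ∀ t ∈ Set.Icc (-1 : ℝ) 1, l * (t - a) + C * (t - a) ^ 2 ≤ C' * U.eval t) ∧
      (∀ ε > 0, 0 < (gegenbauerMeasure lam).real {t | U.eval t ≤ ε}) ∧
      ∃ D : ℝ, ∀ ε > 0, (gegenbauerMeasure lam).real {t | U.eval t ≤ 2 * ε} ≤
        D * (gegenbauerMeasure lam).real {t | U.eval t ≤ ε} by
    obtain ⟨U, hdeg, hU, hest, hpos, D, hD⟩ := this
    refine ⟨U, fun t ht ↦ (hU t ht).1, hest, ?_⟩
    obtain ⟨c, hc, h⟩ := exists_needle (ae_mem_gegenbauerMeasure lam) U hdeg hU hpos D hD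
    refine ⟨c, hc, fun d ↦ ?_⟩
    obtain ⟨p, hp, h1, h2⟩ := h d
    rw [integral_gegenbauerMeasure] at h1 h2
    exact ⟨p, hp, h1, h2⟩
  rcases eq_or_lt_of_le ha.2 with rfl | ha1
  · refine ⟨1 - Polynomial.X, ?_, fun t ht ↦ ?_, fun l C _ ↦ ⟨|l| + 2 * |C|, by positivity,
      fun t ht ↦ ?_⟩, by simpa using doubling_right_endpoint hlam⟩
    · compute_degree
      norm_num
    · simp only [Polynomial.eval_sub, Polynomial.eval_one, Polynomial.eval_X]
      constructor <;> linarith [ht.1, ht.2]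
    · simp only [Polynomial.eval_sub, Polynomial.eval_one, Polynomial.eval_X]
      have h0 : 0 ≤ 1 - t := by linarith [ht.2]
      have h1 : C * (t - 1) ^ 2 ≤ |C| * (2 * (1 - t)) :=
        mul_le_mul (le_abs_self C) (by nlinarith [ht.1]) (sq_nonneg _) (abs_nonneg C)
      have h2 := mul_le_mul_of_nonneg_right (neg_le_abs l) h0
      linarith
  rcases eq_or_lt_of_le ha.1 with rfl | ha0
  · refine ⟨1 + Polynomial.X, ?_, fun t ht ↦ ?_, fun l C _ ↦ ⟨|l| + 2 * |C|, by positivity,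
      fun t ht ↦ ?_⟩, by
        simpa [gegenbauerMeasure_real_symm] using doubling_right_endpoint hlam⟩
    · compute_degree
      norm_num
    · simp only [Polynomial.eval_add, Polynomial.eval_one, Polynomial.eval_X]
      constructor <;> linarith [ht.1, ht.2]
    · simp only [Polynomial.eval_add, Polynomial.eval_one, Polynomial.eval_X]
      have h0 : 0 ≤ 1 + t := by linarith [ht.1]
      have h1 : C * (t - -1) ^ 2 ≤ |C| * (2 * (1 + t)) :=
        mul_le_mul (le_abs_self C) (by nlinarith [ht.2]) (sq_nonneg _) (abs_nonneg C)
      have h2 := mul_le_mul_of_nonneg_right (le_abs_self l) h0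
      linarith
  · have heval (t : ℝ) : (Polynomial.C (1 / 2) * (Polynomial.X - Polynomial.C a) ^ 2).eval t =
        (t - a) ^ 2 / 2 := by
      simp only [Polynomial.eval_mul, Polynomial.eval_C, Polynomial.eval_pow, Polynomial.eval_sub,
        Polynomial.eval_X]
      ring
    refine ⟨Polynomial.C (1 / 2) * (Polynomial.X - Polynomial.C a) ^ 2, ?_, fun t ht ↦ ?_,
      fun l C hl ↦ ⟨2 * |C|, by positivity, fun t ht ↦ ?_⟩, ?_⟩
    · compute_degree
    · rw [heval]
      have h1 : |t - a| ≤ 2 := abs_le.mpr ⟨by linarith [ht.1], by linarith [ht.2]⟩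
      have h2 : |t - a| ^ 2 ≤ 2 ^ 2 := pow_le_pow_left₀ (abs_nonneg _) h1 2
      rw [sq_abs] at h2
      exact ⟨by positivity, by linarith⟩
    · rw [heval, hl ⟨ha0, ha1⟩]
      have := mul_le_mul_of_nonneg_right (le_abs_self C) (sq_nonneg (t - a))
      linarith
    · simp only [heval]
      exact doubling_interior hlam ⟨ha0, ha1⟩

open MvPolynomial in
lemma exists_taylor_bound {n : ℕ} (f : MvPolynomial (Fin n) ℝ) (a : Fin n → ℝ) :
    ∃ (l : Fin n → ℝ) (C : ℝ), 0 ≤ C ∧ ∀ x : Fin n → ℝ, (∀ i, x i ∈ Set.Icc (-1 : ℝ) 1) →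
      |eval x f - eval a f - ∑ i, l i * (x i - a i)| ≤ C * ∑ i, (x i - a i) ^ 2 := by
  induction f using MvPolynomial.induction_on with
  | C r => exact ⟨0, 0, le_rfl, fun x _ ↦ by simp⟩
  | add f g hf hg =>
    obtain ⟨l, C, hC, h⟩ := hf
    obtain ⟨l', C', hC', h'⟩ := hg
    refine ⟨l + l', C + C', by positivity, fun x hx ↦ ?_⟩
    have h1 := abs_add_le (eval x f - eval a f - ∑ i, l i * (x i - a i))
      (eval x g - eval a g - ∑ i, l' i * (x i - a i))
    have h2 := h x hx
    have h3 := h' x hx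
    simp only [map_add, Pi.add_apply, add_mul, Finset.sum_add_distrib]
    refine le_trans (le_of_eq ?_) (h1.trans (add_le_add h2 h3))
    congr 1
    ring
  | mul_X f j hf =>
    obtain ⟨l, C, hC, h⟩ := hf
    refine ⟨fun i ↦ l i * a j + (Pi.single j (eval a f) : Fin n → ℝ) i, C + ∑ i, |l i|,
      add_nonneg hC (Finset.sum_nonneg fun _ _ ↦ abs_nonneg _), fun x hx ↦ ?_⟩
    have hsplit : ∑ i, (l i * a j + (Pi.single j (eval a f) : Fin n → ℝ) i) * (x i - a i) =
        (∑ i, l i * (x i - a i)) * a j + eval a f * (x j - a j) := by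
      simp only [add_mul, Finset.sum_add_distrib, Finset.sum_mul]
      congr 1
      · exact Finset.sum_congr rfl fun i _ ↦ by ring
      · rw [Finset.sum_eq_single j] <;> simp +contextual
    have hlin : |(∑ i, l i * (x i - a i)) * (x j - a j)| ≤
        (∑ i, |l i|) * ∑ i, (x i - a i) ^ 2 := by
      rw [Finset.sum_mul, Finset.sum_mul]
      refine (Finset.abs_sum_le_sum_abs _ _).trans (Finset.sum_le_sum fun i _ ↦ ?_)
      rw [mul_assoc, abs_mul]
      gcongr
      have h0 : ∀ k, (x k - a k) ^ 2 ≤ ∑ i, (x i - a i) ^ 2 := fun k ↦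
        Finset.single_le_sum (f := fun i ↦ (x i - a i) ^ 2) (fun _ _ ↦ sq_nonneg _)
          (Finset.mem_univ k)
      rw [abs_le]
      constructor <;>
        nlinarith [h0 i, h0 j, sq_nonneg (x i - a i + (x j - a j)),
          sq_nonneg (x i - a i - (x j - a j))]
    have hrem : |(eval x f - eval a f - ∑ i, l i * (x i - a i)) * x j| ≤
        C * ∑ i, (x i - a i) ^ 2 := by
      rw [abs_mul]
      calc _ ≤ |eval x f - eval a f - ∑ i, l i * (x i - a i)| * 1 := by
            gcongr
            exact abs_le.mpr (hx j)
        _ ≤ _ := by rw [mul_one]; exact h x hx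
    rw [hsplit, add_mul]
    refine le_trans (le_of_eq ?_) ((abs_add_le _ _).trans (add_le_add hrem hlin))
    simp only [map_mul, eval_X]
    congr 1
    ring

open MvPolynomial in
lemma exists_separable_upper_bound {n : ℕ} (f : MvPolynomial (Fin n) ℝ) (a : Fin n → ℝ)
    (ha : ∀ i, a i ∈ Set.Icc (-1 : ℝ) 1)
    (hmin : ∀ x : Fin n → ℝ, (∀ i, x i ∈ Set.Icc (-1 : ℝ) 1) → eval a f ≤ eval x f) :
    ∃ (l : Fin n → ℝ) (C : ℝ), (∀ i, a i ∈ Set.Ioo (-1 : ℝ) 1 → l i = 0) ∧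
      ∀ x : Fin n → ℝ, (∀ i, x i ∈ Set.Icc (-1 : ℝ) 1) →
        eval x f - eval a f ≤ ∑ i, (l i * (x i - a i) + C * (x i - a i) ^ 2) := by
  obtain ⟨l, C, hC, h⟩ := exists_taylor_bound f a
  refine ⟨l, C, fun j hj ↦ ?_, fun x hx ↦ ?_⟩
  · by_contra hl
    obtain ⟨δ, hδ, hδ1, hδa, hδb⟩ : ∃ δ > 0, δ ≤ 1 ∧ -1 ≤ a j - δ ∧ a j + δ ≤ 1 := by
      refine ⟨min 1 (min (a j + 1) (1 - a j)), ?_, min_le_left _ _, ?_, ?_⟩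
      · exact lt_min one_pos (lt_min (by linarith [hj.1]) (by linarith [hj.2]))
      · linarith [min_le_right 1 (min (a j + 1) (1 - a j)), min_le_left (a j + 1) (1 - a j)]
      · linarith [min_le_right 1 (min (a j + 1) (1 - a j)), min_le_right (a j + 1) (1 - a j)]
    have hl0 : 0 < |l j| := abs_pos.mpr hl
    set τ := δ / (|l j| + C + 1) with hτ
    have hτ0 : 0 < τ := by positivity
    have hτeq : τ * (|l j| + C + 1) = δ := div_mul_cancel₀ _ (by positivity)
    have hs : |l j * τ| ≤ δ := by
      rw [abs_mul, abs_of_pos hτ0]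
      nlinarith
    rw [abs_le] at hs
    have hx : ∀ i, Function.update a j (a j - l j * τ) i ∈ Set.Icc (-1 : ℝ) 1 := by
      intro i
      by_cases hi : i = j
      · subst hi
        rw [Function.update_self]
        constructor <;> linarith [hs.1, hs.2]
      · rw [Function.update_of_ne hi]
        exact ha i
    have h1 := (abs_le.mp (h _ hx)).2
    have h2 := hmin _ hx
    have e1 : ∑ i, l i * (Function.update a j (a j - l j * τ) i - a i) = -(l j ^ 2 * τ) := by
      rw [Finset.sum_eq_single j]
      · rw [Function.update_self]; ring
      · intro i _ hi
        rw [Function.update_of_ne hi]; ring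
      · simp
    have e2 : ∑ i, (Function.update a j (a j - l j * τ) i - a i) ^ 2 = (l j * τ) ^ 2 := by
      rw [Finset.sum_eq_single j]
      · rw [Function.update_self]; ring
      · intro i _ hi
        rw [Function.update_of_ne hi]; ring
      · simp
    rw [e1, e2] at h1
    have h3 : 0 < l j ^ 2 * τ := by positivity
    have h4 : τ * C < 1 := by nlinarith
    nlinarith
  · have h1 := (abs_le.mp (h x hx)).2
    rw [Finset.sum_add_distrib, ← Finset.mul_sum]
    linarith

/-- The cube `[-1, 1]^n` carries the product of the one-dimensional measures. -/
lemma pi_intervalMeasure (n : ℕ) : Measure.pi (fun _ : Fin n ↦ intervalMeasure) =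
    volume.restrict (Set.univ.pi fun _ ↦ Set.Icc (-1 : ℝ) 1) := by
  unfold intervalMeasure
  rw [volume_pi, Measure.restrict_pi_pi]

lemma ae_mem_pi_intervalMeasure (n : ℕ) :
    ∀ᵐ y ∂Measure.pi (fun _ : Fin n ↦ intervalMeasure), ∀ i, y i ∈ Set.Icc (-1 : ℝ) 1 := by
  rw [pi_intervalMeasure]
  filter_upwards [ae_restrict_mem (MeasurableSet.univ_pi fun _ ↦ measurableSet_Icc)] with y hy i
  exact hy i (Set.mem_univ i)

lemma setIntegral_cube {n : ℕ} (g : (Fin n → ℝ) → ℝ) :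
    ∫ x in {x : EuclideanSpace ℝ (Fin n) | ∀ i, x i ∈ Set.Icc (-1 : ℝ) 1}, g (fun i ↦ x i) =
      ∫ y, g y ∂Measure.pi (fun _ : Fin n ↦ intervalMeasure) := by
  rw [pi_intervalMeasure, ← (EuclideanSpace.volume_preserving_symm_measurableEquiv_toLp
    (Fin n)).setIntegral_preimage_emb (MeasurableEquiv.measurableEmbedding _)]
  congr 2
  ext x
  simp only [Set.mem_preimage, Set.mem_univ_pi]
  rfl

lemma integrable_mul_gegenbauerWeight {lam : ℝ} (hlam : -(1 / 2 : ℝ) ≤ lam) {n : ℕ}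
    {g : (Fin n → ℝ) → ℝ} (hg : Continuous g) :
    Integrable (fun y ↦ g y * ∏ i, gegenbauerWeight lam (y i))
      (Measure.pi fun _ : Fin n ↦ intervalMeasure) := by
  obtain ⟨B, hB⟩ := (isCompact_univ_pi fun _ : Fin n ↦ isCompact_Icc (a := (-1 : ℝ))
    (b := 1)).exists_bound_of_continuousOn hg.continuousOn
  refine Integrable.bdd_mul (c := B)
    (Integrable.fintype_prod fun _ ↦ integrable_gegenbauerWeight hlam)
    hg.aestronglyMeasurable ?_
  filter_upwards [ae_mem_pi_intervalMeasure n] with y hy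
  exact hB y fun i _ ↦ hy i

lemma totalDegree_aeval_X_le {n : ℕ} (i : Fin n) (p : Polynomial ℝ) :
    (Polynomial.aeval (MvPolynomial.X i : MvPolynomial (Fin n) ℝ) p).totalDegree ≤
      p.natDegree := by
  rw [Polynomial.aeval_eq_sum_range]
  refine MvPolynomial.totalDegree_finsetSum_le fun k hk ↦ ?_
  refine (MvPolynomial.totalDegree_smul_le _ _).trans ?_
  rw [MvPolynomial.totalDegree_X_pow]
  exact Nat.lt_succ_iff.mp (Finset.mem_range.mp hk)

lemma eval_aeval_X {n : ℕ} (i : Fin n) (p : Polynomial ℝ) (y : Fin n → ℝ) :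
    MvPolynomial.eval y (Polynomial.aeval (MvPolynomial.X i : MvPolynomial (Fin n) ℝ) p) =
      p.eval (y i) := by
  have h := Polynomial.aeval_algHom_apply (MvPolynomial.aeval y)
    (MvPolynomial.X i : MvPolynomial (Fin n) ℝ) p
  rw [MvPolynomial.aeval_X, MvPolynomial.aeval_eq_eval] at h
  simpa using h.symm

/-- The square of a product of univariate polynomials in the separate coordinates. -/
def productDensity {n : ℕ} (p : Fin n → Polynomial ℝ) : MvPolynomial (Fin n) ℝ :=
  (∏ i, Polynomial.aeval (MvPolynomial.X i) (p i)) ^ 2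

lemma isSOS_productDensity {n : ℕ} (p : Fin n → Polynomial ℝ) : IsSOS (productDensity p) :=
  ⟨1, fun _ ↦ ∏ i, Polynomial.aeval (MvPolynomial.X i) (p i), by simp [productDensity]⟩

lemma eval_productDensity {n : ℕ} (p : Fin n → Polynomial ℝ) (y : Fin n → ℝ) :
    MvPolynomial.eval y (productDensity p) = ∏ i, (p i).eval (y i) ^ 2 := by
  simp [productDensity, eval_aeval_X, Finset.prod_pow]

lemma totalDegree_productDensity_le {n d : ℕ} {p : Fin n → Polynomial ℝ}
    (hp : ∀ i, (p i).natDegree ≤ d) : (productDensity p).totalDegree ≤ 2 * (n * d) := by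
  refine (MvPolynomial.totalDegree_pow _ _).trans ?_
  gcongr
  refine (MvPolynomial.totalDegree_finsetProd _ _).trans ?_
  refine (Finset.sum_le_card_nsmul _ _ d fun i _ ↦
    (totalDegree_aeval_X_le i (p i)).trans (hp i)).trans ?_
  simp

lemma integral_productDensity {n : ℕ} {lam : ℝ} {p : Fin n → Polynomial ℝ}
    (hp : ∀ i, ∫ t, (p i).eval t ^ 2 * gegenbauerWeight lam t ∂intervalMeasure = 1) :
    ∫ y, MvPolynomial.eval y (productDensity p) * ∏ i, gegenbauerWeight lam (y i)
      ∂Measure.pi (fun _ : Fin n ↦ intervalMeasure) = 1 := by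
  simp_rw [eval_productDensity, ← Finset.prod_mul_distrib]
  rw [integral_fintype_prod_eq_prod
    (f := fun i t ↦ (p i).eval t ^ 2 * gegenbauerWeight lam t)]
  simp [hp]

lemma integral_mul_productDensity {n : ℕ} {lam : ℝ} {p : Fin n → Polynomial ℝ}
    (hp : ∀ i, ∫ t, (p i).eval t ^ 2 * gegenbauerWeight lam t ∂intervalMeasure = 1)
    (i : Fin n) (U : Polynomial ℝ) :
    ∫ y, U.eval (y i) * MvPolynomial.eval y (productDensity p) *
        ∏ i, gegenbauerWeight lam (y i) ∂Measure.pi (fun _ : Fin n ↦ intervalMeasure) =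
      ∫ t, (p i).eval t ^ 2 * U.eval t * gegenbauerWeight lam t ∂intervalMeasure := by
  set g : Fin n → ℝ → ℝ := Function.update
    (fun j t ↦ (p j).eval t ^ 2 * gegenbauerWeight lam t) i
    (fun t ↦ (p i).eval t ^ 2 * U.eval t * gegenbauerWeight lam t) with hg
  have hgi : g i = fun t ↦ (p i).eval t ^ 2 * U.eval t * gegenbauerWeight lam t :=
    Function.update_self ..
  have hgj {j : Fin n} (hj : j ≠ i) :
      g j = fun t ↦ (p j).eval t ^ 2 * gegenbauerWeight lam t :=
    Function.update_of_ne hj ..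
  have hprod (y : Fin n → ℝ) : U.eval (y i) * MvPolynomial.eval y (productDensity p) *
      ∏ i, gegenbauerWeight lam (y i) = ∏ j, g j (y j) := by
    rw [eval_productDensity, mul_assoc, ← Finset.prod_mul_distrib,
      ← Finset.mul_prod_erase _ _ (Finset.mem_univ i),
      ← Finset.mul_prod_erase _ _ (Finset.mem_univ i), hgi, ← mul_assoc]
    congr 1
    · ring
    · exact Finset.prod_congr rfl fun j hj ↦ by rw [hgj (Finset.ne_of_mem_erase hj)]
  simp_rw [hprod]
  rw [integral_fintype_prod_eq_prod, Finset.prod_eq_single i, hgi]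
  · intro j _ hj
    rw [hgj hj, hp]
  · simp

lemma IsSOS.eval_nonneg {n : ℕ} {q : MvPolynomial (Fin n) ℝ} (hq : IsSOS q) (y : Fin n → ℝ) :
    0 ≤ MvPolynomial.eval y q := by
  obtain ⟨m, p, rfl⟩ := hq
  simp only [map_sum, map_pow]
  exact Finset.sum_nonneg fun _ _ ↦ sq_nonneg _

/-- Theorem: for `K = [-1,1]^n` with weight `ŵ_λ(x) = ∏ᵢ (1 - xᵢ²)^λ`, `λ ≥ -1/2`,
and a polynomial `f` with global minimizer `a` on `K`, the Lasserre error is `O(1/r²)`. -/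
theorem stmt0 {n : ℕ} (lam : ℝ) (hlam : -(1/2 : ℝ) ≤ lam)
    (K : Set (EuclideanSpace ℝ (Fin n)))
    (hK : K = {x : EuclideanSpace ℝ (Fin n) | ∀ i, x i ∈ Set.Icc (-1 : ℝ) 1})
    (w : EuclideanSpace ℝ (Fin n) → ℝ)
    (hw : ∀ x : EuclideanSpace ℝ (Fin n), w x = ∏ i, (1 - x i ^ 2) ^ lam)
    (f : MvPolynomial (Fin n) ℝ)
    (F : EuclideanSpace ℝ (Fin n) → ℝ)
    (hF : ∀ x : EuclideanSpace ℝ (Fin n), F x = MvPolynomial.eval (fun i => x i) f)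
    (a : EuclideanSpace ℝ (Fin n)) (ha : a ∈ K)
    (hmin : ∀ x ∈ K, F a ≤ F x) :
    ∃ c : ℝ, 0 < c ∧ ∀ r : ℕ, 1 ≤ r → lasserreError r K w F ≤ c / (r : ℝ) ^ 2 := by
  have hweight (x : EuclideanSpace ℝ (Fin n)) : w x = ∏ i, gegenbauerWeight lam (x i) := hw x
  have hcube (g : (Fin n → ℝ) → ℝ) : ∫ x in K, g (fun i ↦ x i) * w x =
      ∫ y, g y * ∏ i, gegenbauerWeight lam (y i) ∂Measure.pi (fun _ : Fin n ↦ intervalMeasure) := by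
    rw [hK, ← setIntegral_cube]
    simp only [hweight]
  have ha' : ∀ i, a i ∈ Set.Icc (-1 : ℝ) 1 := by rwa [hK] at ha
  have hmin' : ∀ x : Fin n → ℝ, (∀ i, x i ∈ Set.Icc (-1 : ℝ) 1) →
      MvPolynomial.eval (fun i ↦ a i) f ≤ MvPolynomial.eval x f := fun x hx ↦ by
    have h := hmin (WithLp.toLp 2 x) (by rw [hK]; exact hx)
    rwa [hF, hF] at h
  have hsInf : sInf (F '' K) = F a :=
    IsLeast.csInf_eq ⟨Set.mem_image_of_mem F ha, Set.forall_mem_image.mpr hmin⟩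
  obtain ⟨l, C, hl, hlC⟩ := exists_separable_upper_bound f (fun i ↦ a i) ha' hmin'
  choose U hU hest c hc hneedle using fun i ↦ exists_localizer hlam (ha' i)
  choose C' hC' hestC' using fun i ↦ hest i (l i) C (hl i)
  have hsum0 : 0 ≤ ∑ i, C' i * c i := Finset.sum_nonneg fun i _ ↦ mul_nonneg (hC' i) (hc i).le
  refine ⟨(∑ i, C' i * c i) * (n : ℝ) ^ 2 + 1, by positivity, fun r hr ↦ ?_⟩
  have hr0 : (0 : ℝ) < r := by exact_mod_cast hr
  choose p hpdeg hp1 hpU using fun i ↦ hneedle i (r / n)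
  set q := productDensity p with hq
  have hqdeg : q.totalDegree ≤ 2 * r :=
    (totalDegree_productDensity_le hpdeg).trans (by gcongr; exact Nat.mul_div_le r n)
  have hqcont : Continuous fun y : Fin n → ℝ ↦ MvPolynomial.eval y q :=
    MvPolynomial.continuous_eval q
  have hfcont : Continuous fun y : Fin n → ℝ ↦ MvPolynomial.eval y f :=
    MvPolynomial.continuous_eval f
  set v := ∫ x in K, F x * MvPolynomial.eval (fun i ↦ x i) q * w x with hv
  have hFcube (q : MvPolynomial (Fin n) ℝ) :
      ∫ x in K, F x * MvPolynomial.eval (fun i ↦ x i) q * w x =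
      ∫ y, MvPolynomial.eval y f * MvPolynomial.eval y q * ∏ i, gegenbauerWeight lam (y i)
        ∂Measure.pi (fun _ : Fin n ↦ intervalMeasure) := by
    simp only [hF]
    exact hcube fun y ↦ MvPolynomial.eval y f * MvPolynomial.eval y q
  have hbdd : BddBelow { v : ℝ | ∃ q : MvPolynomial (Fin n) ℝ, IsSOS q ∧ q.totalDegree ≤ 2 * r ∧
      (∫ x in K, MvPolynomial.eval (fun i => x i) q * w x) = 1 ∧
      v = ∫ x in K, F x * MvPolynomial.eval (fun i => x i) q * w x } := by
    refine ⟨F a, ?_⟩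
    rintro _ ⟨q, hsos, -, hq1, rfl⟩
    rw [hcube fun y ↦ MvPolynomial.eval y q] at hq1
    rw [hFcube, ← mul_one (F a), ← hq1, ← integral_const_mul]
    refine integral_mono_ae ((integrable_mul_gegenbauerWeight hlam
      (MvPolynomial.continuous_eval q)).const_mul _) (integrable_mul_gegenbauerWeight hlam
      (hfcont.mul (MvPolynomial.continuous_eval q))) ?_
    filter_upwards [ae_mem_pi_intervalMeasure n] with y hy
    rw [← mul_assoc, hF]
    exact mul_le_mul_of_nonneg_right
      (mul_le_mul_of_nonneg_right (hmin' y hy) (hsos.eval_nonneg y))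
      (Finset.prod_nonneg fun i _ ↦ gegenbauerWeight_nonneg lam (hy i))
  have hq1 := integral_productDensity hp1
  have hle : lasserre r K w F ≤ v :=
    csInf_le hbdd ⟨q, isSOS_productDensity p, hqdeg,
      by rw [hcube fun y ↦ MvPolynomial.eval y q]; exact hq1, rfl⟩
  have hUint (i : Fin n) : Integrable (fun y ↦ C' i * ((U i).eval (y i) *
      MvPolynomial.eval y q * ∏ i, gegenbauerWeight lam (y i)))
      (Measure.pi fun _ : Fin n ↦ intervalMeasure) :=
    (integrable_mul_gegenbauerWeight hlam
      (((U i).continuous.comp (continuous_apply i)).mul hqcont)).const_mul _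
  have hvle : v ≤ F a + ∑ i, C' i * (c i / (((r / n : ℕ) : ℝ) + 1) ^ 2) := by
    calc v ≤ ∫ y, (F a * (MvPolynomial.eval y q * ∏ i, gegenbauerWeight lam (y i)) +
          ∑ i, C' i * ((U i).eval (y i) * MvPolynomial.eval y q *
            ∏ i, gegenbauerWeight lam (y i))) ∂Measure.pi (fun _ : Fin n ↦ intervalMeasure) := by
          rw [hv, hFcube]
          refine integral_mono_ae (integrable_mul_gegenbauerWeight hlam (hfcont.mul hqcont))
            (((integrable_mul_gegenbauerWeight hlam hqcont).const_mul _).add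
              (integrable_finsetSum _ fun i _ ↦ hUint i)) ?_
          filter_upwards [ae_mem_pi_intervalMeasure n] with y hy
          have h1 : MvPolynomial.eval y f ≤ F a + ∑ i, C' i * (U i).eval (y i) := by
            have h2 := hlC y hy
            have h3 : ∑ i, (l i * (y i - a i) + C * (y i - a i) ^ 2) ≤
                ∑ i, C' i * (U i).eval (y i) :=
              Finset.sum_le_sum fun i _ ↦ hestC' i (y i) (hy i)
            rw [hF]
            linarith
          have h0 : 0 ≤ MvPolynomial.eval y q * ∏ i, gegenbauerWeight lam (y i) :=
            mul_nonneg ((isSOS_productDensity p).eval_nonneg y)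
              (Finset.prod_nonneg fun i _ ↦ gegenbauerWeight_nonneg lam (hy i))
          simpa only [add_mul, Finset.sum_mul, mul_assoc] using mul_le_mul_of_nonneg_right h1 h0
      _ = F a + ∑ i, C' i * ∫ t, (p i).eval t ^ 2 * (U i).eval t * gegenbauerWeight lam t
            ∂intervalMeasure := by
          rw [integral_add ((integrable_mul_gegenbauerWeight hlam hqcont).const_mul _)
              (integrable_finsetSum _ fun i _ ↦ hUint i), integral_const_mul, hq1, mul_one,
            integral_finsetSum _ fun i _ ↦ hUint i]
          congr 1
          refine Finset.sum_congr rfl fun i _ ↦ ?_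
          rw [integral_const_mul, integral_mul_productDensity hp1]
      _ ≤ _ := by
          gcongr with i
          · exact hC' i
          · exact hpU i
  have hrate : ∑ i, C' i * (c i / (((r / n : ℕ) : ℝ) + 1) ^ 2) ≤
      (∑ i, C' i * c i) * (n : ℝ) ^ 2 / (r : ℝ) ^ 2 := by
    rw [mul_div_assoc, Finset.sum_mul]
    refine Finset.sum_le_sum fun i _ ↦ ?_
    rw [← mul_div_assoc, div_eq_mul_one_div]
    refine mul_le_mul_of_nonneg_left ?_ (mul_nonneg (hC' i) (hc i).le)
    have hrn : (r : ℝ) ≤ n * (((r / n : ℕ) : ℝ) + 1) := by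
      exact_mod_cast (Nat.lt_mul_div_succ r (Fin.pos i)).le
    rw [div_le_div_iff₀ (by positivity) (by positivity), one_mul, ← mul_pow]
    gcongr
  have hone : (0 : ℝ) < 1 / (r : ℝ) ^ 2 := by positivity
  rw [lasserreError, hsInf, add_div]
  linarith
end
end

section
/- Let K = B^n = {x ∈ ℝⁿ : ‖x‖ ≤ 1} be the closed unit ball (n ≥ 1), let λ ≥ 0, and equip K with the weight function w_λ(x) = (1 - ‖x‖^2)^λ. Let f be an n-variate real polynomial and let a ∈ K be a global minimizer of f on K. Then there exists a constant c > 0 (depending on n, λ, f and a; if λ = 0 it can be chosen independent of a) such that for every integer r ≥ 1 one has E^{(r)}_{K,w_λ}(f) ≤ c / r^2. -/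
open MeasureTheory

noncomputable section

theorem abs_sin_nat_mul_le (m : ℕ) (x : ℝ) : |Real.sin (m * x)| ≤ m * |Real.sin x| := by
  induction m with
  | zero => simp
  | succ k ih =>
    push_cast
    rw [add_mul, one_mul, Real.sin_add, add_mul, one_mul]
    refine (abs_add_le _ _).trans ?_
    rw [abs_mul, abs_mul]
    have h1 := mul_le_of_le_one_right (abs_nonneg (Real.sin (k * x))) (Real.abs_cos_le_one x)
    have h2 := mul_le_of_le_one_left (abs_nonneg (Real.sin x)) (Real.abs_cos_le_one (k * x))
    linarith

/-- A Fejér-type kernel `E` of degree at most `m - 1`, peaked at `0` at scale `1 / m ^ 2`. -/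
theorem exists_peaked_polynomial (m : ℕ) (hm : 1 ≤ m) :
    ∃ E : Polynomial ℝ, E.natDegree ≤ m - 1 ∧ ∀ s : ℝ, 0 ≤ s → s ≤ 1 →
      0 ≤ E.eval s ∧ E.eval s ≤ 1 ∧ (m : ℝ) ^ 2 * s * E.eval s ≤ 1 ∧
      ((m : ℝ) ^ 2 * s ≤ 1 → 1 / 4 ≤ E.eval s) := by
  have hm0 : (0 : ℝ) < m := by exact_mod_cast hm
  set L : Polynomial ℝ := 1 - 2 * Polynomial.X with hL
  set p : Polynomial ℝ := 1 - (Polynomial.Chebyshev.T ℝ m).comp L with hp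
  have hLdeg : L.natDegree ≤ 1 := by
    rw [hL]; compute_degree
  have hpdeg : p.natDegree ≤ m := by
    refine (Polynomial.natDegree_sub_le _ _).trans (max_le (by simp) ?_)
    refine Polynomial.natDegree_comp_le.trans ?_
    rw [Polynomial.Chebyshev.natDegree_T]
    simpa using Nat.mul_le_mul_left m hLdeg
  have hp0 : p.coeff 0 = 0 := by
    rw [Polynomial.coeff_zero_eq_eval_zero]
    simp [hp, hL]
  have hX : Polynomial.X * p.divX = p := by
    have := Polynomial.X_mul_divX_add p
    rwa [hp0, Polynomial.C_0, add_zero] at this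
  have hd0 : p.divX.eval 0 = 2 * (m : ℝ) ^ 2 := by
    rw [← Polynomial.coeff_zero_eq_eval_zero, Polynomial.coeff_divX]
    have h := Polynomial.coeff_derivative p 0
    rw [Polynomial.coeff_zero_eq_eval_zero] at h
    have h2 : (Polynomial.derivative p).eval 0 = 2 * (m : ℝ) ^ 2 := by
      simp [hp, hL, Polynomial.derivative_comp, Polynomial.Chebyshev.T_derivative_eq_U]
      ring
    simp at h ⊢
    linarith
  refine ⟨Polynomial.C (1 / (2 * (m : ℝ) ^ 2)) * p.divX, ?_, fun s hs0 hs1 => ?_⟩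
  · refine (Polynomial.natDegree_C_mul_le _ _).trans ?_
    rw [Polynomial.natDegree_divX_eq_natDegree_tsub_one]
    omega
  rw [Polynomial.eval_mul, Polynomial.eval_C]
  rcases hs0.eq_or_lt with rfl | hs
  · rw [hd0]
    have : 1 / (2 * (m : ℝ) ^ 2) * (2 * (m : ℝ) ^ 2) = 1 := by field_simp
    rw [this]
    norm_num
  set φ := Real.arcsin (√s) with hφ
  have hsq1 : √s ≤ 1 := Real.sqrt_le_one.2 hs1
  have hsin : Real.sin φ = √s := Real.sin_arcsin (by linarith [Real.sqrt_nonneg s]) hsq1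
  have hφ0 : 0 ≤ φ := Real.arcsin_nonneg.2 (Real.sqrt_nonneg s)
  have hφ1 : φ ≤ Real.pi / 2 := Real.arcsin_le_pi_div_two _
  have hsin2 : Real.sin φ ^ 2 = s := by rw [hsin, Real.sq_sqrt hs0]
  have hkey : s * p.divX.eval s = 2 * Real.sin (m * φ) ^ 2 := by
    have h1 : s * p.divX.eval s = p.eval s := by
      conv_rhs => rw [← hX]
      simp
    have h2 : 1 - 2 * s = Real.cos (2 * φ) := by
      rw [Real.cos_two_mul, Real.cos_sq', hsin2]; ring
    rw [h1, hp, hL]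
    simp only [Polynomial.eval_sub, Polynomial.eval_one, Polynomial.eval_comp,
      Polynomial.eval_mul, Polynomial.eval_X, Polynomial.eval_ofNat]
    rw [h2, Polynomial.Chebyshev.T_real_cos]
    have : ((m : ℤ) : ℝ) * (2 * φ) = 2 * (m * φ) := by push_cast; ring
    rw [this, Real.cos_two_mul, Real.cos_sq']; ring
  have hE : 1 / (2 * (m : ℝ) ^ 2) * p.divX.eval s = Real.sin (m * φ) ^ 2 / ((m : ℝ) ^ 2 * s) := by
    field_simp
    linarith
  have hms : 0 < (m : ℝ) ^ 2 * s := by positivity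
  rw [hE]
  have hle : Real.sin (m * φ) ^ 2 ≤ (m : ℝ) ^ 2 * s := by
    have h := abs_sin_nat_mul_le m φ
    have h' := pow_le_pow_left₀ (abs_nonneg _) h 2
    rwa [mul_pow, sq_abs, sq_abs, hsin2] at h'
  refine ⟨by positivity, (div_le_one hms).2 hle, ?_, fun h => ?_⟩
  · rw [mul_div_cancel₀ _ hms.ne']
    exact Real.sin_sq_le_one _
  · rw [le_div_iff₀ hms]
    have hmsin : (m : ℝ) * Real.sin φ ≤ 1 := by
      rw [← abs_of_nonneg (a := (m : ℝ) * Real.sin φ) (by rw [hsin]; positivity)]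
      rw [← sq_le_one_iff_abs_le_one, mul_pow, hsin2]
      exact h
    have hs2 := Real.mul_le_sin hφ0 hφ1
    have hpi := Real.pi_pos
    have hmφ : (m : ℝ) * φ ≤ Real.pi / 2 := by
      have h3 : φ ≤ Real.pi / 2 * Real.sin φ := by
        have := mul_le_mul_of_nonneg_left hs2 (by positivity : 0 ≤ Real.pi / 2)
        have e : Real.pi / 2 * (2 / Real.pi * φ) = φ := by field_simp
        linarith
      have := mul_le_mul_of_nonneg_left h3 hm0.le
      nlinarith
    have h4 := Real.mul_le_sin (x := (m : ℝ) * φ) (by positivity) hmφ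
    have h5 : 1 / 2 ≤ 2 / Real.pi := by
      rw [div_le_div_iff₀ (by norm_num) hpi]; linarith [Real.pi_le_four]
    have h6 : Real.sin φ ≤ φ := Real.sin_le hφ0
    have h7 : 1 / 2 * ((m : ℝ) * Real.sin φ) ≤ Real.sin (m * φ) :=
      (mul_le_mul h5 (mul_le_mul_of_nonneg_left h6 hm0.le)
        (by rw [hsin]; positivity) (by positivity)).trans h4
    have h8 := pow_le_pow_left₀ (by rw [hsin]; positivity) h7 2
    rw [mul_pow, mul_pow, hsin2] at h8
    linarith

theorem totalDegree_aeval_le {σ : Type*} (E : Polynomial ℝ) (p : MvPolynomial σ ℝ) :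
    (Polynomial.aeval p E).totalDegree ≤ E.natDegree * p.totalDegree := by
  rw [Polynomial.aeval_eq_sum_range]
  refine MvPolynomial.totalDegree_finsetSum_le fun i hi => ?_
  refine (MvPolynomial.totalDegree_smul_le _ _).trans ((MvPolynomial.totalDegree_pow _ _).trans ?_)
  exact Nat.mul_le_mul_right _ (Nat.lt_succ_iff.1 (Finset.mem_range.1 hi))

theorem eval_aeval_eq {σ : Type*} (E : Polynomial ℝ) (p : MvPolynomial σ ℝ) (x : σ → ℝ) :
    MvPolynomial.eval x (Polynomial.aeval p E) = E.eval (MvPolynomial.eval x p) := by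
  rw [Polynomial.aeval_def, Polynomial.hom_eval₂, Polynomial.eval₂_eq_eval_map]
  congr 1
  have : (MvPolynomial.eval x).comp (algebraMap ℝ (MvPolynomial σ ℝ)) = RingHom.id ℝ := by
    ext; simp
  rw [this, Polynomial.map_id]

/-- Integrals over the unit ball against `(1 - ‖x‖ ^ 2) ^ lam` are doubling under contraction
by one half towards any point of the ball. -/
theorem setIntegral_half_contraction_le {n : ℕ} (lam : ℝ) (hlam : 0 ≤ lam)
    (a : EuclideanSpace ℝ (Fin n)) (ha : ‖a‖ ≤ 1)
    (w : EuclideanSpace ℝ (Fin n) → ℝ) (hwc : Continuous w)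
    (hw : ∀ x : EuclideanSpace ℝ (Fin n), w x = (1 - ‖x‖ ^ 2) ^ lam)
    (g : EuclideanSpace ℝ (Fin n) → ℝ) (hg : Continuous g) (hg0 : ∀ x, 0 ≤ g x) :
    ∫ x in Metric.closedBall 0 1, g ((1 / 2 : ℝ) • (x + a)) * w x ≤
      2 ^ n * 2 ^ lam * ∫ x in Metric.closedBall 0 1, g x * w x := by
  set K : Set (EuclideanSpace ℝ (Fin n)) := Metric.closedBall 0 1 with hK
  have hKc : IsCompact K := isCompact_closedBall _ _
  have hKm : MeasurableSet K := hKc.measurableSet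
  set H : EuclideanSpace ℝ (Fin n) → ℝ := K.indicator fun x => g x * w x with hH
  have hHint : Integrable H :=
    (integrable_indicator_iff hKm).2 ((hg.mul hwc).continuousOn.integrableOn_compact hKc)
  have hw0 : ∀ x ∈ K, 0 ≤ w x := fun x hx => by
    rw [hw]
    have : ‖x‖ ≤ 1 := by simpa [hK] using hx
    exact Real.rpow_nonneg (by nlinarith [norm_nonneg x]) _
  have hH0 : ∀ x, 0 ≤ H x := fun x =>
    Set.indicator_nonneg (fun y hy => mul_nonneg (hg0 y) (hw0 y hy)) x
  have hint2 : Integrable fun x => H ((1 / 2 : ℝ) • (x + a)) :=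
    (hHint.comp_smul (R := (1 / 2 : ℝ)) (by norm_num)).comp_add_right a
  have hval : ∫ x, H ((1 / 2 : ℝ) • (x + a)) = 2 ^ n * ∫ x, H x := by
    rw [integral_add_right_eq_self (fun x => H ((1 / 2 : ℝ) • x)) a, Measure.integral_comp_smul]
    simp
  have hpt : ∀ x ∈ K, g ((1 / 2 : ℝ) • (x + a)) * w x ≤ 2 ^ lam * H ((1 / 2 : ℝ) • (x + a)) := by
    intro x hx
    have hx1 : ‖x‖ ≤ 1 := by simpa [hK] using hx
    set y := (1 / 2 : ℝ) • (x + a) with hy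
    have hyn : ‖y‖ ≤ (‖x‖ + ‖a‖) / 2 := by
      rw [hy, norm_smul]
      have := norm_add_le x a
      norm_num
      linarith
    have hyK : y ∈ K := by
      simp only [hK, Metric.mem_closedBall, dist_zero_right]; linarith
    rw [hH, Set.indicator_of_mem hyK]
    have hwy : w x ≤ 2 ^ lam * w y := by
      rw [hw, hw, ← Real.mul_rpow (by norm_num)
        (by nlinarith [norm_nonneg y, norm_nonneg x])]
      refine Real.rpow_le_rpow (by nlinarith [norm_nonneg x]) ?_ hlam
      nlinarith [norm_nonneg x, norm_nonneg a, norm_nonneg y, sq_nonneg (‖x‖ - ‖a‖),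
        pow_le_pow_left₀ (norm_nonneg y) hyn 2]
    calc g y * w x ≤ g y * (2 ^ lam * w y) := mul_le_mul_of_nonneg_left hwy (hg0 y)
      _ = _ := by ring
  have hgc : Continuous fun x => g ((1 / 2 : ℝ) • (x + a)) * w x := by fun_prop
  calc ∫ x in K, g ((1 / 2 : ℝ) • (x + a)) * w x
      ≤ ∫ x in K, 2 ^ lam * H ((1 / 2 : ℝ) • (x + a)) :=
        setIntegral_mono_on (hgc.continuousOn.integrableOn_compact hKc)
          (hint2.const_mul _).integrableOn hKm hpt
    _ ≤ ∫ x, 2 ^ lam * H ((1 / 2 : ℝ) • (x + a)) :=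
        setIntegral_le_integral (hint2.const_mul _)
          (Filter.Eventually.of_forall fun x => mul_nonneg (by positivity) (hH0 _))
    _ = 2 ^ n * 2 ^ lam * ∫ x in K, g x * w x := by
        rw [integral_const_mul, hval, hH, integral_indicator hKm]; ring

theorem exists_linear_approx {n : ℕ} (a : EuclideanSpace ℝ (Fin n)) (f : MvPolynomial (Fin n) ℝ) :
    ∃ (L : EuclideanSpace ℝ (Fin n) →L[ℝ] ℝ) (C : ℝ), 0 ≤ C ∧
      ∀ x ∈ Metric.closedBall (0 : EuclideanSpace ℝ (Fin n)) 1,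
        |MvPolynomial.eval (fun i => x i) f - MvPolynomial.eval (fun i => a i) f - L (x - a)| ≤
          C * ‖x - a‖ ^ 2 := by
  induction f using MvPolynomial.induction_on with
  | C r => exact ⟨0, 0, le_rfl, fun x _ => by simp⟩
  | add p q hp hq =>
    obtain ⟨L, C, hC, h⟩ := hp
    obtain ⟨L', C', hC', h'⟩ := hq
    refine ⟨L + L', C + C', by positivity, fun x hx => ?_⟩
    have e : MvPolynomial.eval (fun i => x i) (p + q) - MvPolynomial.eval (fun i => a i) (p + q) -
        (L + L') (x - a) =
        (MvPolynomial.eval (fun i => x i) p - MvPolynomial.eval (fun i => a i) p - L (x - a)) +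
        (MvPolynomial.eval (fun i => x i) q - MvPolynomial.eval (fun i => a i) q - L' (x - a)) := by
      simp only [map_add, add_apply]; ring
    rw [e, add_mul]
    exact (abs_add_le _ _).trans (add_le_add (h x hx) (h' x hx))
  | mul_X p i hp =>
    obtain ⟨L, C, hC, h⟩ := hp
    refine ⟨a i • L + MvPolynomial.eval (fun i => a i) p • EuclideanSpace.proj i,
      C + ‖L‖, by positivity, fun x hx => ?_⟩
    have hxi : |x i| ≤ 1 := by
      have h1 := PiLp.norm_apply_le x i
      have h2 : ‖x‖ ≤ 1 := by simpa using hx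
      rw [Real.norm_eq_abs] at h1; linarith
    have hxa : |x i - a i| ≤ ‖x - a‖ := by
      simpa [Real.norm_eq_abs] using PiLp.norm_apply_le (x - a) i
    have hproj : EuclideanSpace.proj (𝕜 := ℝ) i (x - a) = x i - a i := rfl
    have e : MvPolynomial.eval (fun i => x i) (p * MvPolynomial.X i) -
        MvPolynomial.eval (fun i => a i) (p * MvPolynomial.X i) -
        (a i • L + MvPolynomial.eval (fun i => a i) p • EuclideanSpace.proj i :
          EuclideanSpace ℝ (Fin n) →L[ℝ] ℝ) (x - a) =
        (MvPolynomial.eval (fun i => x i) p - MvPolynomial.eval (fun i => a i) p - L (x - a)) * x i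
          + L (x - a) * (x i - a i) := by
      simp only [map_mul, MvPolynomial.eval_X, add_apply,
        smul_apply, smul_eq_mul, hproj]
      ring
    rw [e, add_mul]
    refine (abs_add_le _ _).trans (add_le_add ?_ ?_)
    · rw [abs_mul]
      exact (mul_le_of_le_one_right (abs_nonneg _) hxi).trans (h x hx)
    · rw [abs_mul, sq, ← mul_assoc]
      exact mul_le_mul (L.le_opNorm _) hxa (abs_nonneg _) (by positivity)

theorem eq_zero_of_forall_quadratic_nonneg {b c : ℝ}
    (h : ∀ t : ℝ, |t| ≤ 1 → 0 ≤ t * b + t ^ 2 * c) : b = 0 := by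
  by_contra hb
  have hc : 0 < |b| + |c| + 1 := by positivity
  have hb' : 0 < |b| := abs_pos.2 hb
  have ht : |-(b / (|b| + |c| + 1))| ≤ 1 := by
    rw [abs_neg, abs_div, abs_of_pos hc, div_le_one hc]
    linarith [abs_nonneg c]
  have := h _ ht
  have e : -(b / (|b| + |c| + 1)) * b + (-(b / (|b| + |c| + 1))) ^ 2 * c =
      b ^ 2 * (c - (|b| + |c| + 1)) / (|b| + |c| + 1) ^ 2 := by
    field_simp
    ring
  rw [e] at this
  have h2 : b ^ 2 * (c - (|b| + |c| + 1)) / (|b| + |c| + 1) ^ 2 < 0 := by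
    apply div_neg_of_neg_of_pos _ (by positivity)
    apply mul_neg_of_pos_of_neg (by positivity)
    linarith [le_abs_self c]
  linarith

/-- At a minimizer `a` over the unit ball, a polynomial `f` is dominated by a quadratic polynomial
`s` which vanishes at `a` and at least halves under contraction by one half towards `a`. -/
theorem exists_quadratic_majorant {n : ℕ} (f : MvPolynomial (Fin n) ℝ)
    (a : EuclideanSpace ℝ (Fin n)) (ha : ‖a‖ ≤ 1)
    (hmin : ∀ x : EuclideanSpace ℝ (Fin n), ‖x‖ ≤ 1 →
      MvPolynomial.eval (fun i => a i) f ≤ MvPolynomial.eval (fun i => x i) f) :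
    ∃ (s : MvPolynomial (Fin n) ℝ) (C : ℝ), s.totalDegree ≤ 2 ∧ 0 ≤ C ∧
      ∀ x : EuclideanSpace ℝ (Fin n), ‖x‖ ≤ 1 →
        0 ≤ MvPolynomial.eval (fun i => x i) s ∧ MvPolynomial.eval (fun i => x i) s ≤ 1 ∧
        MvPolynomial.eval (fun i => ((1 / 2 : ℝ) • (x + a)) i) s ≤
          MvPolynomial.eval (fun i => x i) s / 2 ∧
        MvPolynomial.eval (fun i => x i) f - MvPolynomial.eval (fun i => a i) f ≤
          C * MvPolynomial.eval (fun i => x i) s := by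
  obtain ⟨L, C, hC, hL⟩ := exists_linear_approx a f
  have hup : ∀ x : EuclideanSpace ℝ (Fin n), ‖x‖ ≤ 1 →
      |MvPolynomial.eval (fun i => x i) f - MvPolynomial.eval (fun i => a i) f - L (x - a)| ≤
        C * ‖x - a‖ ^ 2 := fun x hx => hL x (by simpa using hx)
  have hlow : ∀ x : EuclideanSpace ℝ (Fin n), ‖x‖ ≤ 1 → 0 ≤ L (x - a) + C * ‖x - a‖ ^ 2 :=
    fun x hx => by linarith [(abs_le.1 (hup x hx)).2, hmin x hx]
  rcases ha.lt_or_eq with ha1 | ha1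
  · have hL0 : ∀ v, L v = 0 := by
      intro v
      set δ : ℝ := (1 - ‖a‖) / (‖v‖ + 1) with hδ
      have hv1 : 0 < ‖v‖ + 1 := by positivity
      have hδ0 : 0 < δ := div_pos (by linarith) hv1
      have hδv : δ * ‖v‖ ≤ 1 - ‖a‖ := by
        have : δ * (‖v‖ + 1) = 1 - ‖a‖ := by rw [hδ]; field_simp
        nlinarith
      have h0 : δ * L v = 0 := by
        refine eq_zero_of_forall_quadratic_nonneg (c := C * (δ * ‖v‖) ^ 2) fun t ht => ?_
        have hx : ‖a + (t * δ) • v‖ ≤ 1 := by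
          refine (norm_add_le _ _).trans ?_
          rw [norm_smul, norm_mul, Real.norm_eq_abs, Real.norm_eq_abs, abs_of_pos hδ0, mul_assoc]
          have := mul_le_of_le_one_left (by positivity : 0 ≤ δ * ‖v‖) ht
          linarith
        have h := hlow _ hx
        rw [add_sub_cancel_left, map_smul, norm_smul, Real.norm_eq_abs, mul_pow, sq_abs,
          smul_eq_mul] at h
        calc (0 : ℝ) ≤ _ := h
          _ = _ := by ring
      exact (mul_eq_zero.1 h0).resolve_left hδ0.ne'
    refine ⟨MvPolynomial.C (1 / 4) * ∑ i, (MvPolynomial.X i - MvPolynomial.C (a i)) ^ 2, 4 * C,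
      ?_, by positivity, ?_⟩
    · refine (MvPolynomial.totalDegree_mul _ _).trans ?_
      rw [MvPolynomial.totalDegree_C, zero_add]
      refine MvPolynomial.totalDegree_finsetSum_le fun i _ => ?_
      refine (MvPolynomial.totalDegree_pow _ _).trans ?_
      have := (MvPolynomial.totalDegree_sub_C_le (MvPolynomial.X i : MvPolynomial (Fin n) ℝ) (a i))
      rw [MvPolynomial.totalDegree_X] at this
      omega
    have hev : ∀ x : EuclideanSpace ℝ (Fin n), MvPolynomial.eval (fun i => x i)
        (MvPolynomial.C (1 / 4) * ∑ i, (MvPolynomial.X i - MvPolynomial.C (a i)) ^ 2) =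
        ‖x - a‖ ^ 2 / 4 := by
      intro x
      rw [EuclideanSpace.norm_sq_eq]
      simp
      ring
    intro x hx
    rw [hev, hev]
    have hhalf : (1 / 2 : ℝ) • (x + a) - a = (1 / 2 : ℝ) • (x - a) := by module
    have hxa : ‖x - a‖ ≤ 2 := (norm_sub_le _ _).trans (by linarith)
    rw [hhalf, norm_smul]
    refine ⟨by positivity, by nlinarith [norm_nonneg (x - a)], ?_, ?_⟩
    · norm_num
      nlinarith [norm_nonneg (x - a)]
    · have := (abs_le.1 (hup x hx)).2
      rw [hL0] at this
      linarith
  · have haa : inner ℝ a a = (1 : ℝ) := by rw [real_inner_self_eq_norm_sq, ha1]; norm_num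
    have hL0 : ∀ v, inner ℝ a v = (0 : ℝ) → ‖v‖ ≤ 1 → L v = 0 := by
      intro v hav hv
      refine eq_zero_of_forall_quadratic_nonneg (c := - L a + C * (1 + 1)) fun t ht => ?_
      have ht2 : t ^ 2 ≤ 1 := (sq_le_one_iff_abs_le_one t).2 ht
      have hv2 : ‖v‖ ^ 2 ≤ 1 := pow_le_one₀ (norm_nonneg _) hv
      have hnorm : ∀ α β : ℝ, ‖α • a + β • v‖ ^ 2 = α ^ 2 + β ^ 2 * ‖v‖ ^ 2 := by
        intro α β
        rw [norm_add_sq_real, norm_smul, norm_smul, inner_smul_left, inner_smul_right, hav, ha1,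
          mul_pow, mul_pow, Real.norm_eq_abs, Real.norm_eq_abs, sq_abs, sq_abs]
        simp
      have hx : ‖(1 - t ^ 2) • a + t • v‖ ≤ 1 := by
        rw [← abs_of_nonneg (norm_nonneg ((1 - t ^ 2) • a + t • v)), ← sq_le_one_iff_abs_le_one,
          hnorm]
        nlinarith [sq_nonneg t]
      have h := hlow _ hx
      have e : (1 - t ^ 2) • a + t • v - a = (- t ^ 2) • a + t • v := by module
      rw [e, hnorm, map_add, map_smul, map_smul, smul_eq_mul, smul_eq_mul] at h
      have hb : (- t ^ 2) ^ 2 + t ^ 2 * ‖v‖ ^ 2 ≤ t ^ 2 * (1 + 1) := by nlinarith [sq_nonneg t]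
      have := mul_le_mul_of_nonneg_left hb hC
      linarith
    have hL0' : ∀ v, inner ℝ a v = (0 : ℝ) → L v = 0 := by
      intro v hv
      have hv1 : 0 < ‖v‖ + 1 := by positivity
      have := hL0 ((‖v‖ + 1)⁻¹ • v) (by rw [inner_smul_right, hv, mul_zero]) (by
        rw [norm_smul, norm_inv, Real.norm_of_nonneg hv1.le, inv_mul_le_one₀ hv1]; linarith)
      rw [map_smul, smul_eq_mul] at this
      exact (mul_eq_zero.1 this).resolve_left (inv_pos.2 hv1).ne'
    have hLx : ∀ x, L (x - a) = -(1 - inner ℝ a x) * L a := by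
      intro x
      have h := hL0' (x - (inner ℝ a x : ℝ) • a) (by
        rw [inner_sub_right, inner_smul_right, haa]; ring)
      rw [map_sub, map_smul, smul_eq_mul] at h
      rw [map_sub]; linarith
    refine ⟨MvPolynomial.C (1 / 2) * (1 - ∑ i, MvPolynomial.C (a i) * MvPolynomial.X i),
      2 * |L a| + 4 * C, ?_, by positivity, ?_⟩
    · refine (MvPolynomial.totalDegree_mul _ _).trans ?_
      rw [MvPolynomial.totalDegree_C, zero_add]
      refine (MvPolynomial.totalDegree_sub _ _).trans (max_le (by simp) ?_)
      refine MvPolynomial.totalDegree_finsetSum_le fun i _ => ?_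
      refine (MvPolynomial.totalDegree_mul _ _).trans ?_
      simp
    have hev : ∀ x : EuclideanSpace ℝ (Fin n), MvPolynomial.eval (fun i => x i)
        (MvPolynomial.C (1 / 2) * (1 - ∑ i, MvPolynomial.C (a i) * MvPolynomial.X i)) =
        (1 - inner ℝ a x) / 2 := by
      intro x
      simp [PiLp.inner_apply, mul_comm]
      ring
    intro x hx
    rw [hev, hev, inner_smul_right, inner_add_right, haa]
    have hin : |inner ℝ a x| ≤ (1 : ℝ) := by
      refine (abs_real_inner_le_norm a x).trans ?_
      rw [ha1]; linarith
    have hin' := abs_le.1 hin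
    refine ⟨by linarith, by linarith, by linarith, ?_⟩
    have h := (abs_le.1 (hup x hx)).2
    rw [hLx] at h
    have hsq : ‖x - a‖ ^ 2 ≤ 2 * (1 - inner ℝ a x) := by
      rw [norm_sub_sq_real, ha1, real_inner_comm]
      nlinarith [norm_nonneg x]
    have h1 := mul_le_mul_of_nonneg_left hsq hC
    have h2 := mul_le_mul_of_nonneg_left (neg_abs_le (L a)) (by linarith : 0 ≤ 1 - inner ℝ a x)
    linarith

/-- Powers of a kernel peaked at the zero of `s` have first moment of `s` of order `m⁻²`. -/
theorem setIntegral_mul_pow_le {n : ℕ} (lam : ℝ) (hlam : 0 ≤ lam)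
    (a : EuclideanSpace ℝ (Fin n)) (ha : ‖a‖ ≤ 1)
    (w : EuclideanSpace ℝ (Fin n) → ℝ) (hwc : Continuous w)
    (hw : ∀ x : EuclideanSpace ℝ (Fin n), w x = (1 - ‖x‖ ^ 2) ^ lam)
    (s : EuclideanSpace ℝ (Fin n) → ℝ) (hs : Continuous s)
    (hs0 : ∀ x, ‖x‖ ≤ 1 → 0 ≤ s x) (hs1 : ∀ x, ‖x‖ ≤ 1 → s x ≤ 1)
    (hsa : ∀ x, ‖x‖ ≤ 1 → s ((1 / 2 : ℝ) • (x + a)) ≤ s x / 2)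
    (M : ℕ) (hM1 : 1 ≤ M) (hM : 2 * (2 ^ n * (2 : ℝ) ^ lam) ≤ 2 ^ (2 * M - 1))
    (m : ℕ) (hm : 1 ≤ m) (E : Polynomial ℝ)
    (hE : ∀ t : ℝ, 0 ≤ t → t ≤ 1 →
      0 ≤ E.eval t ∧ E.eval t ≤ 1 ∧ (m : ℝ) ^ 2 * t * E.eval t ≤ 1 ∧
      ((m : ℝ) ^ 2 * t ≤ 1 → 1 / 4 ≤ E.eval t)) :
    0 < ∫ x in Metric.closedBall 0 1, E.eval (s x) ^ (2 * M) * w x ∧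
    ∫ x in Metric.closedBall 0 1, s x * E.eval (s x) ^ (2 * M) * w x ≤
      2 * (2 ^ n * 2 ^ lam) * 4 ^ (2 * M) / (m : ℝ) ^ 2 *
        ∫ x in Metric.closedBall 0 1, E.eval (s x) ^ (2 * M) * w x := by
  have hm0 : (0 : ℝ) < m := by exact_mod_cast hm
  set A : ℝ := 2 ^ n * 2 ^ lam with hA
  have hA0 : 0 < A := by positivity
  set K : Set (EuclideanSpace ℝ (Fin n)) := Metric.closedBall 0 1 with hK
  have hKc : IsCompact K := isCompact_closedBall _ _
  have hKm : MeasurableSet K := hKc.measurableSet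
  have hK1 : ∀ x ∈ K, ‖x‖ ≤ 1 := fun x hx => by simpa [hK] using hx
  have hw0 : ∀ x ∈ K, 0 ≤ w x := fun x hx => by
    rw [hw]
    exact Real.rpow_nonneg (by nlinarith [norm_nonneg x, hK1 x hx]) _
  have hφ : ∀ x ∈ K, ‖(1 / 2 : ℝ) • (x + a)‖ ≤ 1 := fun x hx => by
    rw [norm_smul]
    have := norm_add_le x a
    have := hK1 x hx
    norm_num
    linarith
  set q : EuclideanSpace ℝ (Fin n) → ℝ := fun x => E.eval (s x) ^ (2 * M) with hq
  have hqc : Continuous q := by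
    have := E.continuous.comp hs
    exact this.pow _
  have hq0 : ∀ x, 0 ≤ q x := fun x => by
    simp only [hq, pow_mul]; positivity
  set b : EuclideanSpace ℝ (Fin n) → ℝ := fun x => max 1 ((m : ℝ) ^ 2 * s x) with hb
  have hb1 : ∀ x, 1 ≤ b x := fun x => le_max_left _ _
  have hb0 : ∀ x, 0 < b x := fun x => one_pos.trans_le (hb1 x)
  have hbc : Continuous b := by fun_prop
  set g : EuclideanSpace ℝ (Fin n) → ℝ := fun x => (b x)⁻¹ ^ (2 * M - 1) with hg
  have hgc : Continuous g := (hbc.inv₀ fun x => (hb0 x).ne').pow _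
  have hg0 : ∀ x, 0 < g x := fun x => pow_pos (inv_pos.2 (hb0 x)) _
  have hintw : ∀ h : EuclideanSpace ℝ (Fin n) → ℝ, Continuous h →
      IntegrableOn (fun x => h x * w x) K := fun h hh =>
    (hh.mul hwc).continuousOn.integrableOn_compact hKc
  have hgpos : 0 < ∫ x in K, g x * w x := by
    rw [setIntegral_pos_iff_support_of_nonneg_ae _ (hintw g hgc)]
    · refine (Metric.measure_ball_pos volume (0 : EuclideanSpace ℝ (Fin n)) one_pos).trans_le
        (measure_mono fun x hx => ⟨?_, Metric.ball_subset_closedBall hx⟩)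
      have hx1 : ‖x‖ < 1 := by simpa using hx
      refine (mul_pos (hg0 x) ?_).ne'
      rw [hw]
      exact Real.rpow_pos_of_pos (by nlinarith [norm_nonneg x]) _
    · filter_upwards [ae_restrict_mem hKm] with x hx
      exact mul_nonneg (hg0 x).le (hw0 x hx)
  have hsplit : ∀ x ∈ K, g x ≤ 4 ^ (2 * M) * q ((1 / 2 : ℝ) • (x + a)) +
      (2 ^ (2 * M - 1))⁻¹ * g ((1 / 2 : ℝ) • (x + a)) := by
    intro x hx
    set y := (1 / 2 : ℝ) • (x + a) with hy
    have hsy0 := hs0 y (hφ x hx)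
    have hsy := hsa x (hK1 x hx)
    obtain ⟨-, -, -, h4⟩ := hE (s y) hsy0 (hs1 y (hφ x hx))
    rcases le_or_gt ((m : ℝ) ^ 2 * s y) 1 with h | h
    · have h1 : g x ≤ 1 := pow_le_one₀ (inv_pos.2 (hb0 x)).le (inv_le_one_of_one_le₀ (hb1 x))
      have h2 : 1 ≤ 4 ^ (2 * M) * q y := by
        simp only [hq]
        rw [← mul_pow]
        exact one_le_pow₀ (by linarith [h4 h])
      have h3 : 0 ≤ ((2 : ℝ) ^ (2 * M - 1))⁻¹ * g y := mul_nonneg (by positivity) (hg0 y).le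
      linarith
    · have h1 : 0 ≤ 4 ^ (2 * M) * q y := mul_nonneg (by positivity) (hq0 y)
      have h2 : 2 * b y ≤ b x := by
        simp only [hb]
        rw [max_eq_right h.le]
        refine le_trans ?_ (le_max_right _ _)
        have := mul_le_mul_of_nonneg_left hsy (by positivity : 0 ≤ (m : ℝ) ^ 2)
        linarith
      have h3 : g x ≤ (2 ^ (2 * M - 1))⁻¹ * g y := by
        simp only [hg]
        rw [← inv_pow, ← mul_pow, ← mul_inv]
        exact pow_le_pow_left₀ (inv_pos.2 (hb0 x)).le
          (inv_anti₀ (mul_pos two_pos (hb0 y)) h2) _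
      linarith
  have hgle : ∫ x in K, g x * w x ≤ 2 * A * 4 ^ (2 * M) * ∫ x in K, q x * w x := by
    have hc1 := hintw (fun x => q ((1 / 2 : ℝ) • (x + a))) (by fun_prop)
    have hc2 := hintw (fun x => g ((1 / 2 : ℝ) • (x + a))) (by fun_prop)
    have h1 : ∫ x in K, g x * w x ≤ ∫ x in K, (4 ^ (2 * M) * (q ((1 / 2 : ℝ) • (x + a)) * w x) +
        (2 ^ (2 * M - 1))⁻¹ * (g ((1 / 2 : ℝ) • (x + a)) * w x)) := by
      refine setIntegral_mono_on (hintw g hgc) ((hc1.const_mul _).add (hc2.const_mul _)) hKm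
        fun x hx => ?_
      have := mul_le_mul_of_nonneg_right (hsplit x hx) (hw0 x hx)
      linarith
    rw [integral_add (hc1.const_mul _) (hc2.const_mul _), integral_const_mul,
      integral_const_mul] at h1
    have h2 := setIntegral_half_contraction_le lam hlam a ha w hwc hw q hqc hq0
    have h3 := setIntegral_half_contraction_le lam hlam a ha w hwc hw g hgc fun x => (hg0 x).le
    rw [← hA] at h2 h3
    have h4 := mul_le_mul_of_nonneg_left h2 (by positivity : (0 : ℝ) ≤ 4 ^ (2 * M))
    have h5 := mul_le_mul_of_nonneg_left h3 (by positivity : (0 : ℝ) ≤ (2 ^ (2 * M - 1))⁻¹)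
    have h6 : ((2 : ℝ) ^ (2 * M - 1))⁻¹ * A ≤ 1 / 2 := by
      rw [inv_mul_le_iff₀ (by positivity)]; linarith
    have h7 := mul_le_mul_of_nonneg_right h6 hgpos.le
    linarith
  have hqpos : 0 < ∫ x in K, q x * w x := by
    by_contra! hneg
    have := mul_le_mul_of_nonneg_left hneg (by positivity : 0 ≤ 2 * A * 4 ^ (2 * M))
    linarith
  refine ⟨hqpos, ?_⟩
  have hsq : ∀ x ∈ K, (m : ℝ) ^ 2 * (s x * q x * w x) ≤ g x * w x := by
    intro x hx
    obtain ⟨h1, h2, h3, -⟩ := hE (s x) (hs0 x (hK1 x hx)) (hs1 x (hK1 x hx))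
    have h4 : E.eval (s x) ≤ (b x)⁻¹ := by
      rw [← one_div, le_div_iff₀ (hb0 x), hb]
      rcases max_choice 1 ((m : ℝ) ^ 2 * s x) with h | h <;> simp only [h] <;> linarith
    have h5 : (m : ℝ) ^ 2 * (s x * q x) ≤ g x := by
      have e : q x = E.eval (s x) * E.eval (s x) ^ (2 * M - 1) := by
        simp only [hq]
        rw [← pow_succ']
        congr 1
        omega
      have h6 : E.eval (s x) ^ (2 * M - 1) ≤ g x := pow_le_pow_left₀ h1 h4 _
      have h7 := mul_le_of_le_one_left (pow_nonneg h1 (2 * M - 1)) h3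
      rw [e]
      linarith
    have := mul_le_mul_of_nonneg_right h5 (hw0 x hx)
    linarith
  have hfin : (m : ℝ) ^ 2 * ∫ x in K, s x * q x * w x ≤ ∫ x in K, g x * w x := by
    rw [← integral_const_mul]
    exact setIntegral_mono_on ((hintw (fun x => s x * q x) (hs.mul hqc)).const_mul _)
      (hintw g hgc) hKm hsq
  rw [div_mul_eq_mul_div, le_div_iff₀ (by positivity)]
  linarith

theorem stmt2 {n : ℕ} (hn : 1 ≤ n) (lam : ℝ) (hlam : 0 ≤ lam)
    (K : Set (EuclideanSpace ℝ (Fin n)))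
    (hK : K = Metric.closedBall (0 : EuclideanSpace ℝ (Fin n)) 1)
    (w : EuclideanSpace ℝ (Fin n) → ℝ)
    (hw : ∀ x : EuclideanSpace ℝ (Fin n), w x = (1 - ‖x‖ ^ 2) ^ lam)
    (f : MvPolynomial (Fin n) ℝ)
    (F : EuclideanSpace ℝ (Fin n) → ℝ)
    (hF : ∀ x : EuclideanSpace ℝ (Fin n), F x = MvPolynomial.eval (fun i => x i) f)
    (a : EuclideanSpace ℝ (Fin n)) (ha : a ∈ K)
    (hmin : ∀ x ∈ K, F a ≤ F x) :
    ∃ c : ℝ, 0 < c ∧ ∀ r : ℕ, 1 ≤ r → lasserreError r K w F ≤ c / (r : ℝ) ^ 2 := by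
  subst hK
  have hball : ∀ x : EuclideanSpace ℝ (Fin n), x ∈ Metric.closedBall 0 1 ↔ ‖x‖ ≤ 1 := by simp
  have ha1 : ‖a‖ ≤ 1 := (hball a).1 ha
  obtain ⟨s, C, hsdeg, hC, hs⟩ := exists_quadratic_majorant f a ha1 fun x hx => by
    rw [← hF, ← hF]; exact hmin x ((hball x).2 hx)
  have hevc : ∀ p : MvPolynomial (Fin n) ℝ,
      Continuous fun x : EuclideanSpace ℝ (Fin n) => MvPolynomial.eval (fun i => x i) p :=
    fun p => p.continuous_eval.comp (by fun_prop)
  have hFc : Continuous F := (hevc f).congr fun x => (hF x).symm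
  have hwc : Continuous w := by
    have : Continuous fun x : EuclideanSpace ℝ (Fin n) => (1 - ‖x‖ ^ 2) ^ lam :=
      Continuous.rpow_const (by fun_prop) fun _ => Or.inr hlam
    exact this.congr fun x => (hw x).symm
  set K : Set (EuclideanSpace ℝ (Fin n)) := Metric.closedBall 0 1 with hK
  have hKc : IsCompact K := isCompact_closedBall _ _
  have hKm : MeasurableSet K := hKc.measurableSet
  have hw0 : ∀ x ∈ K, 0 ≤ w x := fun x hx => by
    rw [hw]
    exact Real.rpow_nonneg (by nlinarith [norm_nonneg x, (hball x).1 hx]) _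
  have hintw : ∀ h : EuclideanSpace ℝ (Fin n) → ℝ, Continuous h →
      IntegrableOn (fun x => h x * w x) K := fun h hh =>
    (hh.mul hwc).continuousOn.integrableOn_compact hKc
  set M : ℕ := n + ⌈lam⌉₊ + 2 with hM
  have hMle : 2 * (2 ^ n * (2 : ℝ) ^ lam) ≤ 2 ^ (2 * M - 1) := by
    have h1 : (2 : ℝ) ^ lam ≤ 2 ^ ⌈lam⌉₊ := by
      rw [← Real.rpow_natCast]
      exact Real.rpow_le_rpow_of_exponent_le one_le_two (Nat.le_ceil lam)
    calc 2 * (2 ^ n * (2 : ℝ) ^ lam) ≤ 2 * (2 ^ n * 2 ^ ⌈lam⌉₊) := by gcongr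
      _ = 2 ^ (n + ⌈lam⌉₊ + 1) := by ring
      _ ≤ 2 ^ (2 * M - 1) := pow_le_pow_right₀ one_le_two (by omega)
  set B : ℝ := 2 * (2 ^ n * 2 ^ lam) * 4 ^ (2 * M) with hB
  have hB0 : 0 < B := by positivity
  have hM0 : (0 : ℝ) < M := by rw [hM]; positivity
  refine ⟨(C + 1) * B * (2 * M) ^ 2, by positivity, fun r hr => ?_⟩
  have hr0 : (0 : ℝ) < r := by exact_mod_cast hr
  set m : ℕ := r / (2 * M) + 1 with hm
  have hm1 : 1 ≤ m := Nat.le_add_left _ _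
  obtain ⟨E, hEdeg, hE⟩ := exists_peaked_polynomial m hm1
  obtain ⟨hI, hbound⟩ := setIntegral_mul_pow_le lam hlam a ha1 w hwc hw
    (fun x => MvPolynomial.eval (fun i => x i) s) (hevc s) (fun x hx => (hs x hx).1)
    (fun x hx => (hs x hx).2.1) (fun x hx => (hs x hx).2.2.1) M (by omega) hMle m hm1 E hE
  rw [← hB, ← hK] at hbound
  rw [← hK] at hI
  set I : ℝ := ∫ x in K, E.eval (MvPolynomial.eval (fun i => x i) s) ^ (2 * M) * w x with hIdef
  set p : MvPolynomial (Fin n) ℝ := MvPolynomial.C (√I)⁻¹ * Polynomial.aeval s E ^ M with hp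
  have hpev : ∀ x : EuclideanSpace ℝ (Fin n), MvPolynomial.eval (fun i => x i) (p ^ 2) =
      I⁻¹ * E.eval (MvPolynomial.eval (fun i => x i) s) ^ (2 * M) := by
    intro x
    rw [hp, mul_pow, ← pow_mul, map_mul, map_pow, map_pow, MvPolynomial.eval_C, eval_aeval_eq,
      inv_pow, Real.sq_sqrt hI.le, mul_comm M 2]
  have hpdeg : (p ^ 2).totalDegree ≤ 2 * r := by
    refine (MvPolynomial.totalDegree_pow _ _).trans (Nat.mul_le_mul_left 2 ?_)
    refine (MvPolynomial.totalDegree_mul _ _).trans ?_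
    rw [MvPolynomial.totalDegree_C, zero_add]
    refine (MvPolynomial.totalDegree_pow _ _).trans ?_
    have h1 := (totalDegree_aeval_le E s).trans (Nat.mul_le_mul hEdeg hsdeg)
    calc M * (Polynomial.aeval s E).totalDegree ≤ M * ((m - 1) * 2) := Nat.mul_le_mul_left _ h1
      _ = 2 * M * (r / (2 * M)) := by rw [hm, Nat.add_sub_cancel]; ring
      _ ≤ r := Nat.mul_div_le _ _
  have hpint : ∫ x in K, MvPolynomial.eval (fun i => x i) (p ^ 2) * w x = 1 := by
    simp_rw [hpev, mul_assoc]
    rw [integral_const_mul, ← hIdef, inv_mul_cancel₀ hI.ne']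
  have hsub : ∀ q : MvPolynomial (Fin n) ℝ,
      (∫ x in K, MvPolynomial.eval (fun i => x i) q * w x) = 1 →
      (∫ x in K, F x * MvPolynomial.eval (fun i => x i) q * w x) - F a =
        ∫ x in K, (F x - F a) * MvPolynomial.eval (fun i => x i) q * w x := by
    intro q hq1
    have h1 := hintw (fun x => F x * MvPolynomial.eval (fun i => x i) q) (hFc.mul (hevc q))
    have h2 := (hintw _ (hevc q)).const_mul (F a)
    calc _ = (∫ x in K, F x * MvPolynomial.eval (fun i => x i) q * w x) -
          ∫ x in K, F a * (MvPolynomial.eval (fun i => x i) q * w x) := by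
          rw [integral_const_mul, hq1, mul_one]
      _ = _ := by
          rw [← integral_sub h1 h2]
          exact integral_congr_ae (Filter.Eventually.of_forall fun x => by ring)
  have hmem : lasserre r K w F ≤
      ∫ x in K, F x * MvPolynomial.eval (fun i => x i) (p ^ 2) * w x := by
    refine csInf_le ⟨F a, ?_⟩ ⟨p ^ 2, ⟨1, fun _ => p, by simp⟩, hpdeg, hpint, rfl⟩
    rintro v ⟨q, ⟨k, u, rfl⟩, -, hq1, rfl⟩
    rw [← sub_nonneg, hsub _ hq1]
    refine setIntegral_nonneg hKm fun x hx => ?_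
    refine mul_nonneg (mul_nonneg (sub_nonneg.2 (hmin x hx)) ?_) (hw0 x hx)
    rw [map_sum]
    exact Finset.sum_nonneg fun i _ => by rw [map_pow]; positivity
  have hinf : sInf (F '' K) = F a :=
    IsLeast.csInf_eq ⟨⟨a, ha, rfl⟩, by rintro _ ⟨x, hx, rfl⟩; exact hmin x hx⟩
  have hmr : (r : ℝ) ≤ 2 * M * m := by
    have h1 := Nat.lt_mul_div_succ r (by omega : 0 < 2 * M)
    exact_mod_cast h1.le
  have hm0 : (0 : ℝ) < m := by rw [hm]; positivity
  have hmain : ∫ x in K, (F x - F a) * MvPolynomial.eval (fun i => x i) (p ^ 2) * w x ≤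
      C * (B / (m : ℝ) ^ 2) := by
    calc ∫ x in K, (F x - F a) * MvPolynomial.eval (fun i => x i) (p ^ 2) * w x
        ≤ ∫ x in K, C * I⁻¹ * (MvPolynomial.eval (fun i => x i) s *
            E.eval (MvPolynomial.eval (fun i => x i) s) ^ (2 * M) * w x) := by
          refine setIntegral_mono_on
            (hintw (fun x => (F x - F a) * MvPolynomial.eval (fun i => x i) (p ^ 2))
              ((hFc.sub continuous_const).mul (hevc _)))
            ((hintw (fun x => MvPolynomial.eval (fun i => x i) s *
              E.eval (MvPolynomial.eval (fun i => x i) s) ^ (2 * M))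
              ((hevc s).mul ((E.continuous.comp (hevc s)).pow _))).const_mul _) hKm fun x hx => ?_
          have h1 := (hs x ((hball x).1 hx)).2.2.2
          rw [← hF, ← hF] at h1
          have h2 : 0 ≤ I⁻¹ * E.eval (MvPolynomial.eval (fun i => x i) s) ^ (2 * M) * w x := by
            rw [pow_mul]
            exact mul_nonneg (by positivity) (hw0 x hx)
          have := mul_le_mul_of_nonneg_right h1 h2
          rw [hpev]
          linarith
      _ ≤ C * I⁻¹ * (B / (m : ℝ) ^ 2 * I) := by
          rw [integral_const_mul]
          exact mul_le_mul_of_nonneg_left hbound (by positivity)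
      _ = C * (B / (m : ℝ) ^ 2) := by field_simp
  have hlast : C * (B / (m : ℝ) ^ 2) ≤ (C + 1) * B * (2 * M) ^ 2 / (r : ℝ) ^ 2 := by
    rw [mul_div_assoc', div_le_div_iff₀ (by positivity) (by positivity)]
    have h1 := pow_le_pow_left₀ hr0.le hmr 2
    calc C * B * (r : ℝ) ^ 2 ≤ (C + 1) * B * (2 * M * m) ^ 2 := by gcongr; linarith
      _ = _ := by ring
  rw [lasserreError, hinf]
  linarith [hsub _ hpint]
end
end
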